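/- Let G be a finite solvable group with Noether index n(G). Then G has a characteristic cyclic subgroup of index at most n(G)^{10}. -/

import Mathlib

/-!  Definition of the Noether number `β(G)` of a group `G`, over the field `ℂ`
(of characteristic 0).  A finite-dimensional `ℂG`-module is (up to isomorphism)
given by a representation `ρ : Representation ℂ G (Fin n → ℂ)`; the algebra of
polynomial invariants is realised inside `MvPolynomial (Fin n) ℂ` as the
common equalizer of the substitution maps induced by the group elements. -/

/-- The algebra endomorphism of the polynomial ring induced by the linear action of
`g : G` on the underlying space (substitution of the variables by linear forms). -/
noncomputable def Representation.polySubst {G : Type*} [Group G] {n : ℕ}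
    (ρ : Representation ℂ G (Fin n → ℂ)) (g : G) :
    MvPolynomial (Fin n) ℂ →ₐ[ℂ] MvPolynomial (Fin n) ℂ :=
  MvPolynomial.aeval fun i =>
    ∑ j, MvPolynomial.C (LinearMap.toMatrix' (ρ g) i j) * MvPolynomial.X j

/-- The subalgebra of `G`-invariant polynomials. -/
noncomputable def Representation.invariantAlgebra {G : Type*} [Group G] {n : ℕ}
    (ρ : Representation ℂ G (Fin n → ℂ)) : Subalgebra ℂ (MvPolynomial (Fin n) ℂ) :=
  ⨅ g : G, AlgHom.equalizer (ρ.polySubst g) (AlgHom.id ℂ (MvPolynomial (Fin n) ℂ))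

/-- The invariant algebra is generated by its elements of (total) degree at most `d`. -/
def Representation.InvariantsGeneratedInDegree {G : Type*} [Group G] {n : ℕ}
    (ρ : Representation ℂ G (Fin n → ℂ)) (d : ℕ) : Prop :=
  Algebra.adjoin ℂ {f : MvPolynomial (Fin n) ℂ | f ∈ ρ.invariantAlgebra ∧ f.totalDegree ≤ d}
    = ρ.invariantAlgebra

/-- The Noether number `β(G)`: the smallest degree bound `d` such that for every
finite-dimensional `ℂG`-module the algebra of polynomial invariants is generated
by its elements of degree at most `d`.  (Equivalently, the maximum over all
finite-dimensional modules `V` of the minimal generating degree `β(G,V)`.) -/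
noncomputable def noetherNumber (G : Type*) [Group G] : ℕ :=
  sInf {d : ℕ | ∀ (n : ℕ) (ρ : Representation ℂ G (Fin n → ℂ)),
    ρ.InvariantsGeneratedInDegree d}

/-- The Noether index `n(G) = |G| / β(G)`, as a real number. -/
noncomputable def noetherIndex (G : Type*) [Group G] : ℝ :=
  (Nat.card G : ℝ) / (noetherNumber G : ℝ)

/-- The ideal generated by the invariants contained in the ideal `I`. -/
def hilbertIdeal {G R : Type*} [Group G] [CommRing R] [Algebra ℂ R] (ρ : G →* (R →ₐ[ℂ] R))
    (I : Ideal R) : Ideal R :=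
  Ideal.span {x | x ∈ I ∧ ∀ g, ρ g x = x}

/-- For every action of `G` on a commutative `ℂ`-algebra by automorphisms, the `d`-th power of
any stable ideal `I` is contained in the ideal generated by the invariants of `I`. -/
def HilbertIdealBound (G : Type*) [Group G] (d : ℕ) : Prop :=
  ∀ (R : Type) [CommRing R] [Algebra ℂ R] (ρ : G →* (R →ₐ[ℂ] R)) (I : Ideal R),
    (∀ g, ∀ x ∈ I, ρ g x ∈ I) → I ^ d ≤ hilbertIdeal ρ I

section Action

variable {G R : Type*} [Group G] [CommRing R] [Algebra ℂ R] (ρ : G →* (R →ₐ[ℂ] R)) {I : Ideal R}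

theorem sum_apply_mem_hilbertIdeal [Fintype G] (hI : ∀ g, ∀ x ∈ I, ρ g x ∈ I) {x : R}
    (hx : x ∈ I) : ∑ g, ρ g x ∈ hilbertIdeal ρ I := by
  refine Ideal.subset_span ⟨Ideal.sum_mem _ fun g _ => hI g x hx, fun g => ?_⟩
  rw [map_sum]
  simp_rw [← AlgHom.mul_apply, ← map_mul]
  exact Fintype.sum_equiv (Equiv.mulLeft g) _ _ fun _ => rfl

/-- The exchange principle: modulo the Hilbert ideal, a product of elements of `I` invariant under
a normal subgroup `A` can be rewritten in terms of products in which some of the factors have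
been moved by group elements outside finitely many prescribed cosets of `A`. -/
theorem prod_mul_mem_hilbertIdeal [Finite G] (hI : ∀ g, ∀ x ∈ I, ρ g x ∈ I) (A : Subgroup G)
    [A.Normal] {ι : Type*} [DecidableEq ι] {s : Finset ι} (hs : s.Nonempty) (c : ι → G)
    (f : ι → R) (hfI : ∀ i ∈ s, f i ∈ I) (hfA : ∀ i ∈ s, ∀ a ∈ A, ρ a (f i) = f i) (q : R)
    (H : ∀ t : G, (∀ i ∈ s, (c i)⁻¹ * t ∉ A) → ∀ T ⊆ s, T.Nonempty →
      (∏ i ∈ T, ρ (t * (c i)⁻¹) (f i)) * (∏ i ∈ s \ T, f i) * q ∈ hilbertIdeal ρ I) :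
    (∏ i ∈ s, f i) * q ∈ hilbertIdeal ρ I := by
  classical
  have := Fintype.ofFinite G
  set J := hilbertIdeal ρ I with hJ
  let ε : R := (-1) ^ s.card
  have expand (t : G) : (∏ i ∈ s, (ρ (t * (c i)⁻¹) (f i) + -f i)) * q =
      (∑ T ∈ s.powerset.erase ∅, (-1) ^ (s \ T).card * ((∏ i ∈ T, ρ (t * (c i)⁻¹) (f i)) *
        (∏ i ∈ s \ T, f i) * q)) + ε * ((∏ i ∈ s, f i) * q) := by
    rw [Finset.prod_add, ← Finset.sum_erase_add _ _ (Finset.empty_mem_powerset s), add_mul,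
      Finset.sum_mul]
    congr 1
    · refine Finset.sum_congr rfl fun T _ => ?_
      rw [Finset.prod_neg]; ring
    · simp only [Finset.prod_empty, Finset.sdiff_empty, one_mul, Finset.prod_neg, ε]; ring
  have hall : ∑ t : G, ((∏ i ∈ s, (ρ (t * (c i)⁻¹) (f i) + -f i)) * q
      - ε * ((∏ i ∈ s, f i) * q)) ∈ J := by
    simp_rw [expand, add_sub_cancel_right]
    rw [Finset.sum_comm]
    refine Ideal.sum_mem _ fun T hT => ?_
    obtain ⟨hT0, hTs⟩ := Finset.mem_erase.1 hT
    rw [Finset.mem_powerset] at hTs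
    obtain ⟨i₀, hi₀⟩ := Finset.nonempty_iff_ne_empty.2 hT0
    have : ∑ t : G, (-1) ^ (s \ T).card * ((∏ i ∈ T, ρ (t * (c i)⁻¹) (f i)) *
        (∏ i ∈ s \ T, f i) * q) = ((-1) ^ (s \ T).card * (∏ i ∈ s \ T, f i) * q) *
        ∑ t : G, ρ t (∏ i ∈ T, ρ (c i)⁻¹ (f i)) := by
      rw [Finset.mul_sum]
      refine Finset.sum_congr rfl fun t _ => ?_
      simp_rw [map_prod, ← AlgHom.mul_apply, ← map_mul]
      ring
    rw [this]
    refine Ideal.mul_mem_left _ _ (sum_apply_mem_hilbertIdeal ρ hI ?_)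
    exact Ideal.prod_mem (I := I) hi₀ (hI _ _ (hfI _ (hTs hi₀)))
  let P : G → Prop := fun t => ∀ i ∈ s, (c i)⁻¹ * t ∉ A
  have hmiss : ∑ t : G with P t, ((∏ i ∈ s, (ρ (t * (c i)⁻¹) (f i) + -f i)) * q
      - ε * ((∏ i ∈ s, f i) * q)) ∈ J := by
    refine Ideal.sum_mem _ fun t ht => ?_
    rw [expand, add_sub_cancel_right]
    refine Ideal.sum_mem _ fun T hT => Ideal.mul_mem_left _ _ ?_
    obtain ⟨hT0, hTs⟩ := Finset.mem_erase.1 hT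
    exact H t (Finset.mem_filter.1 ht).2 T (Finset.mem_powerset.1 hTs)
      (Finset.nonempty_iff_ne_empty.2 hT0)
  have hhit : ∑ t : G with ¬ P t, ((∏ i ∈ s, (ρ (t * (c i)⁻¹) (f i) + -f i)) * q
      - ε * ((∏ i ∈ s, f i) * q)) =
      -(((Finset.univ.filter fun t => ¬ P t).card : R) * (ε * ((∏ i ∈ s, f i) * q))) := by
    rw [Finset.sum_congr rfl (g := fun _ => -(ε * ((∏ i ∈ s, f i) * q))), Finset.sum_const,
      nsmul_eq_mul, mul_neg]
    intro t ht
    have ht' := (Finset.mem_filter.1 ht).2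
    simp only [P, not_forall, not_not] at ht'
    obtain ⟨i, hi, hti⟩ := ht'
    have : t * (c i)⁻¹ ∈ A := by
      simpa [mul_assoc] using ‹A.Normal›.conj_mem _ hti (c i)
    rw [Finset.prod_eq_zero hi (by rw [hfA i hi _ this, add_neg_cancel]), zero_mul, zero_sub]
  have key : ((Finset.univ.filter fun t => ¬ P t).card : R) * (ε * ((∏ i ∈ s, f i) * q)) ∈ J := by
    rw [← Finset.sum_filter_add_sum_filter_not _ P, hhit] at hall
    simpa using (J.neg_mem ((Submodule.add_mem_iff_right J hmiss).1 hall))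
  obtain ⟨i₁, hi₁⟩ := hs
  have hcard : ((Finset.univ.filter fun t => ¬ P t).card : ℂ) ≠ 0 := by
    rw [Nat.cast_ne_zero, Finset.card_ne_zero]
    exact ⟨c i₁, by simpa [P] using ⟨i₁, hi₁, by simp⟩⟩
  have h2 := J.mul_mem_left (ε * algebraMap ℂ R ((Finset.univ.filter fun t => ¬ P t).card : ℂ)⁻¹)
    key
  convert h2 using 1
  have e1 : algebraMap ℂ R ((Finset.univ.filter fun t => ¬ P t).card : ℂ)⁻¹ *
      ((Finset.univ.filter fun t => ¬ P t).card : R) = 1 := by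
    rw [← map_natCast (algebraMap ℂ R), ← map_mul, inv_mul_cancel₀ hcard, map_one]
  have e2 : ε * ε = 1 := by rw [← mul_pow]; simp
  linear_combination (-(∏ i ∈ s, f i) * q) * e1 -
    (∏ i ∈ s, f i) * q * algebraMap ℂ R ((Finset.univ.filter fun t => ¬ P t).card : ℂ)⁻¹ *
      ((Finset.univ.filter fun t => ¬ P t).card : R) * e2

end Action

theorem Ideal.pow_card_le_of_prod_mem {R ι : Type*} [CommRing R] {I J : Ideal R} (s : Finset ι)
    (h : ∀ f : ι → R, (∀ i ∈ s, f i ∈ I) → ∏ i ∈ s, f i ∈ J) : I ^ s.card ≤ J := by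
  rw [← Finset.prod_const, ← Ideal.span_eq I, Ideal.prod_span, Ideal.span_le]
  intro x hx
  obtain ⟨f, hf, rfl⟩ := (Set.mem_finsetProd _ _ _).1 hx
  exact h f fun i hi => hf hi

/-- **Noether's bound.** -/
theorem hilbertIdealBound_card (G : Type*) [Group G] [Finite G] :
    HilbertIdealBound G (Nat.card G) := by
  classical
  have := Fintype.ofFinite G
  intro R _ _ ρ I hI
  rw [Nat.card_eq_fintype_card, ← Finset.card_univ]
  refine Ideal.pow_card_le_of_prod_mem _ fun f hf => ?_
  have := prod_mul_mem_hilbertIdeal ρ hI ⊥ Finset.univ_nonempty id f hf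
    (fun i _ a ha => by rw [Subgroup.mem_bot.1 ha]; simp) 1
    (fun t ht => absurd (ht t (Finset.mem_univ t)) (by simp))
  simpa using this

theorem HilbertIdealBound.of_mulEquiv {G H : Type*} [Group G] [Group H] (e : G ≃* H) {d : ℕ}
    (h : HilbertIdealBound H d) : HilbertIdealBound G d := by
  intro R _ _ ρ I hI
  refine (h R (ρ.comp e.symm.toMonoidHom) I fun g => hI _).trans (Ideal.span_mono ?_)
  rintro x ⟨hx, hx'⟩
  exact ⟨hx, fun g => by simpa using hx' (e g)⟩



/-- Submultiplicativity of the bound for group extensions. -/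
theorem HilbertIdealBound.extension {G : Type*} [Group G] (N : Subgroup G) [N.Normal] {a b : ℕ}
    (ha : HilbertIdealBound N a) (hb : HilbertIdealBound (G ⧸ N) b) :
    HilbertIdealBound G (a * b) := by
  intro R _ _ ρ I hI
  let S : Subalgebra ℂ R := ⨅ n : N, AlgHom.equalizer (ρ n) (AlgHom.id ℂ R)
  have mem_S (x : R) : x ∈ S ↔ ∀ n : N, ρ n x = x := by simp [S, Algebra.mem_iInf]
  have hS (g : G) (x : R) (hx : x ∈ S) : ρ g x ∈ S := by
    rw [mem_S] at hx ⊢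
    intro n
    have h := hx ⟨g⁻¹ * n * g, by simpa using ‹N.Normal›.conj_mem _ n.2 g⁻¹⟩
    conv_rhs => rw [← h]
    simp_rw [← AlgHom.mul_apply, ← map_mul]
    simp [mul_assoc]
  let τ : G →* (S →ₐ[ℂ] S) :=
    { toFun := fun g => ((ρ g).comp S.val).codRestrict S fun x => hS g x x.2
      map_one' := by ext x; simp
      map_mul' := fun g h => by ext x; simp; rfl }
  have hτ (n : G) (hn : n ∈ N) : τ n = 1 := by
    ext x
    exact (mem_S x).1 x.2 ⟨n, hn⟩
  let σ : G ⧸ N →* (S →ₐ[ℂ] S) := QuotientGroup.lift N τ hτ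
  let J : Ideal S := I.comap S.val
  have hσ : ∀ g, ∀ x ∈ J, σ g x ∈ J := by
    intro g
    obtain ⟨g, rfl⟩ := QuotientGroup.mk_surjective g
    exact fun x hx => hI g x hx
  have h1 : hilbertIdeal (ρ.comp N.subtype) I ≤ J.map S.val := by
    refine Ideal.span_le.2 ?_
    rintro x ⟨hx, hx'⟩
    exact Ideal.mem_map_of_mem S.val (I := J) (x := ⟨x, (mem_S x).2 hx'⟩) hx
  have h2 : (hilbertIdeal σ J).map S.val ≤ hilbertIdeal ρ I := by
    rw [hilbertIdeal, Ideal.map_span, Ideal.span_le]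
    rintro _ ⟨x, ⟨hx, hx'⟩, rfl⟩
    exact Ideal.subset_span ⟨hx, fun g => congrArg Subtype.val (hx' g)⟩
  rw [pow_mul]
  refine le_trans ?_ h2
  refine le_trans ?_ (Ideal.map_mono (hb S σ J hσ))
  rw [Ideal.map_pow]
  exact Ideal.pow_right_mono ((ha R _ I fun g => hI _).trans h1) b

section NoetherNumber

open MvPolynomial

variable {G : Type*} [Group G] {n : ℕ} (ρ : Representation ℂ G (Fin n → ℂ))

theorem Representation.polySubst_one : ρ.polySubst 1 = AlgHom.id ℂ _ := by
  refine MvPolynomial.algHom_ext fun i => ?_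
  simp [Representation.polySubst, Pi.single_apply, apply_ite C]

theorem Representation.polySubst_mul (g h : G) :
    ρ.polySubst (g * h) = (ρ.polySubst h).comp (ρ.polySubst g) := by
  refine MvPolynomial.algHom_ext fun i => ?_
  simp only [Representation.polySubst, map_mul, Module.End.mul_eq_comp, LinearMap.toMatrix'_comp,
    Matrix.mul_apply, aeval_X, AlgHom.comp_apply, map_sum, algHom_C, Finset.mul_sum,
    Finset.sum_mul, algebraMap_eq]
  rw [Finset.sum_comm]
  simp only [mul_assoc]

/-- The left action of `G` on polynomial functions. -/
noncomputable def Representation.polyAction :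
    G →* (MvPolynomial (Fin n) ℂ →ₐ[ℂ] MvPolynomial (Fin n) ℂ) where
  toFun g := ρ.polySubst g⁻¹
  map_one' := by rw [inv_one, ρ.polySubst_one]; rfl
  map_mul' g h := by rw [mul_inv_rev, ρ.polySubst_mul]; rfl

theorem Representation.mem_invariantAlgebra {f : MvPolynomial (Fin n) ℂ} :
    f ∈ ρ.invariantAlgebra ↔ ∀ g, ρ.polyAction g f = f := by
  have : f ∈ ρ.invariantAlgebra ↔ ∀ g, ρ.polySubst g f = f := by
    simp [Representation.invariantAlgebra, Algebra.mem_iInf]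
  exact this.trans ⟨fun h g => h g⁻¹, fun h g => by simpa [polyAction] using h g⁻¹⟩

theorem Representation.isHomogeneous_polyAction (g : G) {m : ℕ} {f : MvPolynomial (Fin n) ℂ}
    (hf : f.IsHomogeneous m) : (ρ.polyAction g f).IsHomogeneous m := by
  rw [← one_mul m]
  refine hf.aeval _ fun i => IsHomogeneous.sum _ _ _ fun j _ => ?_
  simpa using (isHomogeneous_C _ _).mul (isHomogeneous_X ℂ j)

theorem Representation.homogeneousComponent_polyAction (g : G) (m : ℕ)
    (f : MvPolynomial (Fin n) ℂ) :
    homogeneousComponent m (ρ.polyAction g f) = ρ.polyAction g (homogeneousComponent m f) := by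
  conv_lhs => rw [← sum_homogeneousComponent f, map_sum, map_sum]
  have (i : ℕ) := homogeneousComponent_of_mem (m := m)
    (ρ.isHomogeneous_polyAction g (homogeneousComponent_isHomogeneous i f))
  simp_rw [this, Finset.sum_ite_eq]
  split_ifs with h
  · rfl
  · rw [homogeneousComponent_eq_zero _ _ (by simpa [Nat.lt_succ_iff] using h), map_zero]

theorem Representation.polyAction_mem_idealOfVars (g : G) {f : MvPolynomial (Fin n) ℂ}
    (hf : f ∈ idealOfVars (Fin n) ℂ) : ρ.polyAction g f ∈ idealOfVars (Fin n) ℂ := by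
  have key (p : MvPolynomial (Fin n) ℂ) :
      p ∈ idealOfVars (Fin n) ℂ ↔ homogeneousComponent 0 p = 0 := by
    rw [← pow_one (idealOfVars (Fin n) ℂ), mem_pow_idealOfVars_iff', homogeneousComponent_zero,
      C_eq_zero]
    exact ⟨fun h => h 0 (by simp), fun h x hx => by
      rwa [(Finsupp.degree_eq_zero_iff x).1 (Nat.lt_one_iff.1 hx)]⟩
  rw [key] at hf ⊢
  rw [homogeneousComponent_polyAction, hf, map_zero]

theorem HilbertIdealBound.invariantsGeneratedInDegree [Finite G] {d : ℕ}
    (hd : HilbertIdealBound G d) : ρ.InvariantsGeneratedInDegree d := by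
  classical
  have := Fintype.ofFinite G
  set 𝔪 := idealOfVars (Fin n) ℂ with h𝔪
  set τ := ρ.polyAction with hτ
  set A := Algebra.adjoin ℂ
    {f : MvPolynomial (Fin n) ℂ | f ∈ ρ.invariantAlgebra ∧ f.totalDegree ≤ d} with hA
  have hinv (x : MvPolynomial (Fin n) ℂ) (g : G) : τ g (∑ h, τ h x) = ∑ h, τ h x := by
    rw [map_sum]
    simp_rw [← AlgHom.mul_apply, ← map_mul]
    exact Fintype.sum_equiv (Equiv.mulLeft g) _ _ fun _ => rfl
  have hom (m : ℕ) : ∀ f : MvPolynomial (Fin n) ℂ, f.IsHomogeneous m → (∀ g, τ g f = f) →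
      f ∈ A := by
    induction m using Nat.strong_induction_on with
    | _ m ih =>
    intro f hf hfinv
    rcases le_or_gt m d with hmd | hmd
    · exact Algebra.subset_adjoin ⟨ρ.mem_invariantAlgebra.2 hfinv, hf.totalDegree_le.trans hmd⟩
    have hfm : f ∈ 𝔪 * hilbertIdeal τ 𝔪 := by
      refine Ideal.mul_mono_right (hd _ τ 𝔪 fun g x => ρ.polyAction_mem_idealOfVars g) ?_
      rw [← pow_succ']
      refine Ideal.pow_le_pow_right hmd ((mem_pow_idealOfVars_iff _ _).2 fun x hx => ?_)
      rw [hf.degree_eq_sum_deg_support hx]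
      exact le_rfl
    have hzero (x : MvPolynomial (Fin n) ℂ) (hx : x ∈ 𝔪) : homogeneousComponent 0 x = 0 := by
      rw [homogeneousComponent_zero, C_eq_zero]
      rw [h𝔪, ← pow_one (idealOfVars (Fin n) ℂ), mem_pow_idealOfVars_iff'] at hx
      exact hx 0 (by simp)
    have hQ : ∀ a ∈ 𝔪, ∀ h ∈ hilbertIdeal τ 𝔪,
        ∑ g, τ g (homogeneousComponent m (a * h)) ∈ A := by
      intro a ha h hh
      induction hh using Submodule.span_induction generalizing a with
      | zero => simp
      | add x y _ _ hx hy =>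
        simpa [mul_add, Finset.sum_add_distrib] using A.add_mem (hx a ha) (hy a ha)
      | smul r x _ hx => 
        rw [smul_eq_mul, ← mul_assoc]
        exact hx _ (𝔪.mul_mem_right r ha)
      | mem s hs =>
        obtain ⟨hs, hsinv⟩ := hs
        rw [← sum_homogeneousComponent a, ← sum_homogeneousComponent s, Finset.sum_mul_sum]
        simp_rw [map_sum]
        rw [Finset.sum_comm]
        refine A.sum_mem fun i _ => ?_
        rw [Finset.sum_comm]
        refine A.sum_mem fun j _ => ?_
        rw [homogeneousComponent_of_mem ((homogeneousComponent_isHomogeneous i a).mul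
          (homogeneousComponent_isHomogeneous j s))]
        split_ifs with hij
        swap
        · simp
        have hsj (g : G) : τ g (homogeneousComponent j s) = homogeneousComponent j s := by
          rw [← ρ.homogeneousComponent_polyAction, hsinv]
        simp_rw [map_mul, hsj, ← Finset.sum_mul]
        rcases Nat.eq_zero_or_pos i with rfl | hi
        · simp [hzero a ha]
        rcases Nat.eq_zero_or_pos j with rfl | hj
        · simp [hzero s hs]
        refine A.mul_mem (ih i (by omega) _ (IsHomogeneous.sum _ _ _ fun g _ => ?_) (hinv _))
          (ih j (by omega) _ (homogeneousComponent_isHomogeneous j s) hsj)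
        exact ρ.isHomogeneous_polyAction g (homogeneousComponent_isHomogeneous i a)
    have hQ' : ∑ g, τ g (homogeneousComponent m f) ∈ A := by
      refine Submodule.mul_induction_on hfm hQ fun x y hx hy => ?_
      simpa [Finset.sum_add_distrib] using A.add_mem hx hy
    rw [homogeneousComponent_eq_self hf] at hQ'
    simp_rw [hfinv, Finset.sum_const, Finset.card_univ] at hQ'
    have := A.smul_mem hQ' (Fintype.card G : ℂ)⁻¹
    rwa [← Nat.cast_smul_eq_nsmul ℂ, smul_smul, inv_mul_cancel₀ (by simp), one_smul] at this
  refine le_antisymm (Algebra.adjoin_le fun f hf => hf.1) fun f hf => ?_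
  rw [← sum_homogeneousComponent f]
  refine Subalgebra.sum_mem _ fun i _ =>
    hom i _ (homogeneousComponent_isHomogeneous i f) fun g => ?_
  rw [← ρ.homogeneousComponent_polyAction, ρ.mem_invariantAlgebra.1 hf]

end NoetherNumber

theorem HilbertIdealBound.noetherNumber_le {G : Type*} [Group G] [Finite G] {d : ℕ}
    (hd : HilbertIdealBound G d) : noetherNumber G ≤ d :=
  Nat.sInf_le fun _ ρ => hd.invariantsGeneratedInDegree ρ

theorem noetherNumber_pos (G : Type*) [Group G] [Finite G] : 0 < noetherNumber G := by
  rw [Nat.pos_iff_ne_zero]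
  intro h0
  have hne : {d : ℕ | ∀ (n : ℕ) (ρ : Representation ℂ G (Fin n → ℂ)),
      ρ.InvariantsGeneratedInDegree d}.Nonempty :=
    ⟨_, fun _ ρ => (hilbertIdealBound_card G).invariantsGeneratedInDegree ρ⟩
  have h := Nat.sInf_mem hne 1 (Representation.trivial ℂ G (Fin 1 → ℂ))
  change Representation.InvariantsGeneratedInDegree _ (noetherNumber G) at h
  rw [h0, Representation.InvariantsGeneratedInDegree] at h
  set ρ := Representation.trivial ℂ G (Fin 1 → ℂ)
  have hX : (MvPolynomial.X 0 : MvPolynomial (Fin 1) ℂ) ∈ ρ.invariantAlgebra := by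
    rw [ρ.mem_invariantAlgebra]
    intro g
    simp [Representation.polyAction, Representation.polySubst, ρ, ← Module.End.one_eq_id]
  rw [← h] at hX
  have hbot : Algebra.adjoin ℂ {f : MvPolynomial (Fin 1) ℂ | f ∈ ρ.invariantAlgebra ∧
      f.totalDegree ≤ 0} ≤ ⊥ := by
    refine Algebra.adjoin_le fun f hf => ?_
    rw [(MvPolynomial.totalDegree_eq_zero_iff_eq_C).1 (Nat.le_zero.1 hf.2)]
    exact Subalgebra.algebraMap_mem _ _
  obtain ⟨c, hc⟩ := Algebra.mem_bot.1 (hbot hX)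
  have := congrArg (MvPolynomial.coeff (Finsupp.single 0 1)) hc
  rw [MvPolynomial.algebraMap_eq, MvPolynomial.coeff_C, if_neg (by simp [eq_comm])] at this
  simp at this

section Weights

variable {R V W : Type*} [CommRing R] [Algebra ℂ R] [AddCommGroup V]

/-- The elements of `I` on which `V` acts through the character `χ`. -/
def weightSpace (σ : Multiplicative V →* (R →ₐ[ℂ] R)) (I : Ideal R) (χ : AddChar V ℂ) :
    Submodule ℂ R where
  carrier := {x | x ∈ I ∧ ∀ v, σ (Multiplicative.ofAdd v) x = χ v • x}
  add_mem' := fun ⟨hx, hx'⟩ ⟨hy, hy'⟩ =>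
    ⟨I.add_mem hx hy, fun v => by rw [map_add, hx', hy', smul_add]⟩
  zero_mem' := ⟨I.zero_mem, fun v => by simp⟩
  smul_mem' := fun c x ⟨hx, hx'⟩ =>
    ⟨Submodule.smul_of_tower_mem I c hx, fun v => by rw [map_smul, hx', smul_comm]⟩

variable [Fintype V] [DecidableEq V] [Fintype W] {σ : Multiplicative V →* (R →ₐ[ℂ] R)}
  {I : Ideal R} {e : W → AddChar V ℂ}

theorem exists_sum_weightSpace (he : ∀ v, ∑ w, e w v = if v = 0 then (Fintype.card V : ℂ) else 0)
    (hI : ∀ v, ∀ x ∈ I, σ v x ∈ I) {x : R} (hx : x ∈ I) :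
    ∃ y : W → R, (∀ w, y w ∈ weightSpace σ I (e w)) ∧ ∑ w, y w = x := by
  refine ⟨fun w => (Fintype.card V : ℂ)⁻¹ • ∑ v, e w (-v) • σ (Multiplicative.ofAdd v) x,
    fun w => Submodule.smul_mem _ _ ⟨?_, fun u => ?_⟩, ?_⟩
  · exact I.sum_mem fun v _ => Submodule.smul_of_tower_mem I _ (hI _ _ hx)
  · rw [map_sum, Finset.smul_sum]
    refine Fintype.sum_equiv (Equiv.addLeft u) _ _ fun v => ?_
    rw [map_smul, ← AlgHom.mul_apply, ← map_mul, smul_smul, ← AddChar.map_add_eq_mul]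
    simp [ofAdd_add]
  · rw [← Finset.smul_sum, Finset.sum_comm]
    simp_rw [← Finset.sum_smul, he, neg_eq_zero, ite_smul, zero_smul]
    simp [smul_smul]

/-- To bound a power of an ideal it suffices to consider products of weight vectors. -/
theorem pow_le_of_weightSpace
    (he : ∀ v, ∑ w, e w v = if v = 0 then (Fintype.card V : ℂ) else 0)
    (hI : ∀ v, ∀ x ∈ I, σ v x ∈ I) {d : ℕ} {K : Ideal R}
    (h : ∀ (w : Fin d → W) (f : Fin d → R), (∀ i, f i ∈ weightSpace σ I (e (w i))) →
      ∏ i, f i ∈ K) : I ^ d ≤ K := by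
  classical
  rw [← Fintype.card_fin d, ← Finset.card_univ]
  refine Ideal.pow_card_le_of_prod_mem _ fun f hf => ?_
  choose y hy hyf using fun i => exists_sum_weightSpace he hI (hf i (Finset.mem_univ i))
  simp_rw [← hyf, Finset.prod_univ_sum]
  exact K.sum_mem fun w _ => h w _ fun i => hy i _

end Weights

theorem prod_mem_weightSpace {R V ι : Type*} [CommRing R] [Algebra ℂ R] [AddCommGroup V]
    {σ : Multiplicative V →* (R →ₐ[ℂ] R)} {I : Ideal R} {χ : ι → AddChar V ℂ} {s : Finset ι}
    (hs : s.Nonempty) {f : ι → R} (hf : ∀ i ∈ s, f i ∈ weightSpace σ I (χ i)) :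
    ∏ i ∈ s, f i ∈ weightSpace σ I (∏ i ∈ s, χ i) := by
  obtain ⟨i, hi⟩ := hs
  refine ⟨Ideal.prod_mem (I := I) hi (hf i hi).1, fun v => ?_⟩
  rw [map_prod, AddChar.prod_apply, ← Finset.prod_smul]
  exact Finset.prod_congr rfl fun j hj => (hf j hj).2 v

theorem AddChar.map_finsetSum {A M ι : Type*} [AddCommMonoid A] [CommMonoid M] (ψ : AddChar A M)
    (s : Finset ι) (f : ι → A) : ψ (∑ i ∈ s, f i) = ∏ i ∈ s, ψ (f i) := by
  classical
  induction s using Finset.induction_on with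
  | empty => simp
  | insert i s hi ih => rw [Finset.sum_insert hi, Finset.prod_insert hi, map_add_eq_mul, ih]

/-- The Davenport constant of `(ℤ/p)^r` is at most `r(p-1)+1`. -/
theorem exists_nonempty_sum_eq_zero {p : ℕ} [Fact p.Prime] {κ ι : Type*} [Fintype κ] [Fintype ι]
    (w : ι → κ → ZMod p) (h : Fintype.card κ * (p - 1) < Fintype.card ι) :
    ∃ T : Finset ι, T.Nonempty ∧ ∑ i ∈ T, w i = 0 := by
  classical
  have hp := (Fact.out : p.Prime).two_le
  let f : κ → MvPolynomial ι (ZMod p) := fun k =>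
    ∑ i, MvPolynomial.C (w i k) * MvPolynomial.X i ^ (p - 1)
  have hf (k : κ) : (f k).totalDegree ≤ p - 1 := by
    refine MvPolynomial.totalDegree_finsetSum_le fun i _ => ?_
    refine (MvPolynomial.totalDegree_mul _ _).trans ?_
    simp [MvPolynomial.totalDegree_X_pow]
  have hdvd := char_dvd_card_solutions_of_fintype_sum_lt p (f := f) <| by
    refine lt_of_le_of_lt (Finset.sum_le_sum fun k _ => hf k) ?_
    simpa using h
  have h0 : ∀ k, MvPolynomial.eval (0 : ι → ZMod p) (f k) = 0 := fun k => by
    simp [f, zero_pow (show p - 1 ≠ 0 by omega)]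
  have hone : 1 < Fintype.card {x : ι → ZMod p // ∀ k, MvPolynomial.eval x (f k) = 0} :=
    lt_of_lt_of_le (by omega) (Nat.le_of_dvd (Fintype.card_pos_iff.2 ⟨⟨0, h0⟩⟩) hdvd)
  obtain ⟨⟨x, hx⟩, hx0⟩ := Fintype.exists_ne_of_one_lt_card hone ⟨0, h0⟩
  have hx0 : x ≠ 0 := fun h => hx0 (Subtype.ext h)
  obtain ⟨i, hi⟩ := Function.ne_iff.1 hx0
  refine ⟨Finset.univ.filter fun i => x i ≠ 0, ⟨i, by simpa using hi⟩, ?_⟩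
  ext k
  have := hx k
  simp only [f, map_sum, map_mul, MvPolynomial.eval_C, map_pow, MvPolynomial.eval_X] at this
  rw [Finset.sum_apply, Pi.zero_apply, Finset.sum_filter]
  refine Eq.trans ?_ this
  refine Finset.sum_congr rfl fun i _ => ?_
  split_ifs with hi
  · rw [ZMod.pow_card_sub_one_eq_one hi, mul_one]
  · rw [not_not.1 hi, zero_pow (by omega), mul_zero]

theorem hilbertIdealBound_pi_zmod (p : ℕ) [Fact p.Prime] (κ : Type*) [Fintype κ] :
    HilbertIdealBound (Multiplicative (κ → ZMod p)) (Fintype.card κ * (p - 1) + 1) := by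
  classical
  intro R _ _ ρ I hI
  let e : (κ → ZMod p) → AddChar (κ → ZMod p) ℂ := fun w =>
    (ZMod.stdAddChar (N := p)).compAddMonoidHom
      (AddMonoidHom.mk' (fun v => w ⬝ᵥ v) fun a b => dotProduct_add w a b)
  have e_apply (w v) : e w v = ZMod.stdAddChar (w ⬝ᵥ v) := rfl
  have e_sum {ι : Type} (s : Finset ι) (w : ι → κ → ZMod p) :
      ∏ i ∈ s, e (w i) = e (∑ i ∈ s, w i) := by
    ext v
    rw [AddChar.prod_apply, e_apply, sum_dotProduct, AddChar.map_finsetSum]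
    rfl
  have he (v) : ∑ w, e w v = if v = 0 then (Fintype.card (κ → ZMod p) : ℂ) else 0 := by
    let χ : AddChar (κ → ZMod p) ℂ := e v
    have hχ (w) : e w v = χ w := by rw [e_apply, e_apply, dotProduct_comm]
    simp_rw [hχ, AddChar.sum_eq_ite]
    congr 1
    rw [eq_iff_iff]
    constructor
    · intro h0
      ext k
      have := DFunLike.congr_fun h0 (Pi.single k 1)
      rw [e_apply, dotProduct_single_one, AddChar.zero_apply,
        ← (ZMod.stdAddChar (N := p)).map_zero_eq_one] at this
      exact ZMod.injective_stdAddChar this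
    · rintro rfl
      ext w
      simp [χ, e_apply]
  refine pow_le_of_weightSpace he hI fun w f hf => ?_
  obtain ⟨T, hT, hT0⟩ := exists_nonempty_sum_eq_zero w (by simp)
  have hmem := prod_mem_weightSpace hT fun i _ => hf i
  rw [e_sum, hT0] at hmem
  rw [← Finset.prod_mul_prod_compl T]
  refine Ideal.mul_mem_right _ _ (Ideal.subset_span ⟨hmem.1, fun g => ?_⟩)
  have := hmem.2 g.toAdd
  rwa [ofAdd_toAdd, e_apply, zero_dotProduct, AddChar.map_zero_eq_one, one_smul] at this

/-- The reduction rules satisfied by those sequences of weights of a normal subgroup of order `p`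
for which every product of weight vectors lies in the Hilbert ideal. The group `H` is the group of
automorphisms induced on the normal subgroup. -/
structure IsReductionSystem {p : ℕ} (H : Subgroup (ZMod p)ˣ) (Good : Multiset (ZMod p) → Prop) :
    Prop where
  add : ∀ c c', Good c → Good (c + c')
  contract : ∀ S c, S ≠ 0 → S.sum = 0 → Good (0 ::ₘ c) → Good (S + c)
  exchange : ∀ (s : Finset (ZMod p)) (u : ZMod p → (ZMod p)ˣ) (S : ZMod p → Multiset (ZMod p))
    (c : Multiset (ZMod p)), s.Nonempty → (∀ i ∈ s, u i ∈ H) → (∀ i ∈ s, S i ≠ 0) →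
    (∀ i ∈ s, (S i).sum = 0) →
    (∀ t ∈ H, (∀ i ∈ s, u i ≠ t) → ∀ T ⊆ s, T.Nonempty →
      Good (∑ i ∈ T, (S i).map (fun w => ((t * (u i)⁻¹ : (ZMod p)ˣ) : ZMod p) * w) + ∑ i ∈ s \ T, S i + c)) →
    Good (∑ i ∈ s, S i + c)

theorem Submodule.prod_mul_le {K R ι : Type*} [CommRing K] [CommRing R] [Algebra K R]
    (s : Finset ι) (N : ι → Submodule K R) (Q P : Submodule K R)
    (h : ∀ f : ι → R, (∀ i ∈ s, f i ∈ N i) → ∀ q ∈ Q, (∏ i ∈ s, f i) * q ∈ P) :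
    (∏ i ∈ s, N i) * Q ≤ P := by
  have (i : ι) : N i = Submodule.span K (N i : Set R) := (Submodule.span_eq _).symm
  rw [Finset.prod_congr rfl fun i _ => this i, ← Submodule.span_eq Q, Submodule.prod_span,
    Submodule.span_mul_span, Submodule.span_le]
  rintro _ ⟨x, hx, q, hq, rfl⟩
  obtain ⟨f, hf, rfl⟩ := (Set.mem_finsetProd _ _ _).1 hx
  exact h f (fun i hi => hf hi) q hq

theorem Submodule.prod_mem_finsetProd {K R ι : Type*} [CommRing K] [CommRing R] [Algebra K R]
    {s : Finset ι} {N : ι → Submodule K R} {f : ι → R} (h : ∀ i ∈ s, f i ∈ N i) :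
    ∏ i ∈ s, f i ∈ ∏ i ∈ s, N i := by
  classical
  induction s using Finset.induction_on with
  | empty => exact Submodule.one_le.1 le_rfl
  | insert i s hi ih =>
    rw [Finset.prod_insert hi, Finset.prod_insert hi]
    exact Submodule.mul_mem_mul (h i (Finset.mem_insert_self i s))
      (ih fun j hj => h j (Finset.mem_insert_of_mem hj))

section

variable {p : ℕ} [Fact p.Prime] {B R : Type*} [Group B] [CommRing R] [Algebra ℂ R]

/-- The character of `ℤ/p` attached to a weight. -/
noncomputable def zmodChar (w : ZMod p) : AddChar (ZMod p) ℂ :=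
  AddChar.mulShift (ZMod.stdAddChar (N := p)) w

theorem zmodChar_apply (w v : ZMod p) : zmodChar w v = ZMod.stdAddChar (w * v) := rfl

theorem zmodChar_add (w w' : ZMod p) : zmodChar (w + w') = zmodChar w * zmodChar w' := by
  ext v
  rw [AddChar.mul_apply, zmodChar_apply, zmodChar_apply, zmodChar_apply, add_mul,
    AddChar.map_add_eq_mul]

theorem sum_zmodChar (v : ZMod p) :
    ∑ w, zmodChar w v = if v = 0 then (Fintype.card (ZMod p) : ℂ) else 0 := by
  simp_rw [zmodChar_apply]
  rw [AddChar.sum_mulShift v (ZMod.isPrimitive_stdAddChar p)]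
  split_ifs <;> simp

/-- The product of the weight spaces belonging to a sequence of weights. -/
noncomputable def weightProd (σ : Multiplicative (ZMod p) →* (R →ₐ[ℂ] R)) (I : Ideal R)
    (c : Multiset (ZMod p)) : Submodule ℂ R :=
  (c.map fun w => weightSpace σ I (zmodChar w)).prod

variable {σ : Multiplicative (ZMod p) →* (R →ₐ[ℂ] R)} {I : Ideal R}

theorem weightProd_add (c c' : Multiset (ZMod p)) :
    weightProd σ I (c + c') = weightProd σ I c * weightProd σ I c' := by
  simp [weightProd]

theorem weightProd_sum {ι : Type*} (s : Finset ι) (c : ι → Multiset (ZMod p)) :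
    weightProd σ I (∑ i ∈ s, c i) = ∏ i ∈ s, weightProd σ I (c i) := by
  classical
  induction s using Finset.induction_on with
  | empty => simp [weightProd]
  | insert i s hi ih => rw [Finset.sum_insert hi, Finset.prod_insert hi, weightProd_add, ih]

theorem weightProd_cons (w : ZMod p) (c : Multiset (ZMod p)) :
    weightProd σ I (w ::ₘ c) = weightSpace σ I (zmodChar w) * weightProd σ I c := by
  simp [weightProd]

theorem weightProd_le_weightSpace {S : Multiset (ZMod p)} (hS : S ≠ 0) :
    weightProd σ I S ≤ weightSpace σ I (zmodChar S.sum) := by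
  induction S using Multiset.induction_on with
  | empty => exact absurd rfl hS
  | cons w S ih =>
    rcases eq_or_ne S 0 with rfl | hS0
    · simp [weightProd]
    rw [weightProd_cons, Multiset.sum_cons]
    refine (mul_le_mul' le_rfl (ih hS0)).trans (Submodule.mul_le.2 fun x hx y hy => ?_)
    refine ⟨I.mul_mem_left _ hy.1, fun v => ?_⟩
    rw [map_mul, hx.2, hy.2, zmodChar_add, AddChar.mul_apply, smul_mul_smul_comm]

theorem weightSpace_zmodChar_zero {x : R} (hx : x ∈ weightSpace σ I (zmodChar 0))
    (v : Multiplicative (ZMod p)) : σ v x = x := by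
  have := hx.2 v.toAdd
  rwa [ofAdd_toAdd, zmodChar_apply, zero_mul, AddChar.map_zero_eq_one, one_smul] at this

/-- The sequences of weights all of whose products lie in the Hilbert ideal form a reduction
system. -/
theorem isReductionSystem_hilbertIdeal [Finite B] (α : Multiplicative (ZMod p) →* B)
    (k : B →* (ZMod p)ˣ)
    (hk : ∀ g v, α (Multiplicative.ofAdd v) * g = g * α (Multiplicative.ofAdd (k g * v)))
    (hker : k.ker = α.range) (ρ : B →* (R →ₐ[ℂ] R)) (hI : ∀ g, ∀ x ∈ I, ρ g x ∈ I) :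
    IsReductionSystem k.range fun c =>
      weightProd (ρ.comp α) I c ≤ (hilbertIdeal ρ I).restrictScalars ℂ := by
  have move (g : B) (S : Multiset (ZMod p)) (x : R) (hx : x ∈ weightProd (ρ.comp α) I S) :
      ρ g x ∈ weightProd (ρ.comp α) I (S.map fun w => k g * w) := by
    suffices h : (weightProd (ρ.comp α) I S).map (ρ g).toLinearMap ≤
        weightProd (ρ.comp α) I (S.map fun w => k g * w) from h ⟨x, hx, rfl⟩
    clear hx
    induction S using Multiset.induction_on with
    | empty => simp [weightProd, Submodule.map_one]
    | cons w S ih =>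
      rw [Multiset.map_cons, weightProd_cons, weightProd_cons, Submodule.map_mul]
      refine mul_le_mul' ?_ ih
      rintro _ ⟨y, hy, rfl⟩
      refine ⟨hI g y hy.1, fun v => ?_⟩
      have h1 := hy.2 (k g * v)
      simp only [MonoidHom.comp_apply] at h1 ⊢
      rw [AlgHom.toLinearMap_apply, ← AlgHom.mul_apply, ← map_mul, hk, map_mul, AlgHom.mul_apply,
        h1, map_smul]
      simp only [zmodChar_apply]
      ring_nf
  refine ⟨fun c c' hc => ?_, fun S c hS hsum hc => ?_, fun s u S c hs hu hS hsum h => ?_⟩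
  · rw [weightProd_add]
    refine Submodule.mul_le.2 fun x hx y _ => Ideal.mul_mem_right _ _ (hc hx)
  · refine le_trans ?_ hc
    rw [weightProd_add, weightProd_cons]
    refine mul_le_mul' ?_ le_rfl
    rw [← hsum]
    exact weightProd_le_weightSpace hS
  · choose! b hb using fun i hi => MonoidHom.mem_range.1 (hu i hi)
    rw [weightProd_add, weightProd_sum]
    refine Submodule.prod_mul_le _ _ _ _ fun f hf q hq => ?_
    have hf0 (i) (hi : i ∈ s) : f i ∈ weightSpace (ρ.comp α) I (zmodChar 0) := by
      rw [← hsum i hi]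
      exact weightProd_le_weightSpace (hS i hi) (hf i hi)
    refine prod_mul_mem_hilbertIdeal ρ hI k.ker hs b f (fun i hi => (hf0 i hi).1) ?_ q ?_
    · intro i hi a ha
      rw [hker] at ha
      obtain ⟨v, rfl⟩ := ha
      exact weightSpace_zmodChar_zero (hf0 i hi) v
    · intro t ht T hTs hT
      have := h (k t) ⟨t, rfl⟩ (fun i hi hit => ht i hi ?_) T hTs hT
      · rw [weightProd_add, weightProd_add, weightProd_sum, weightProd_sum] at this
        refine this (Submodule.mul_mem_mul (Submodule.mul_mem_mul ?_ ?_) hq)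
        · refine Submodule.prod_mem_finsetProd fun i hi => ?_
          rw [← hb i (hTs hi), ← map_inv, ← map_mul]
          exact move _ _ _ (hf i (hTs hi))
        · exact Submodule.prod_mem_finsetProd fun i hi => hf i (Finset.mem_sdiff.1 hi).1
      · rw [MonoidHom.mem_ker, map_mul, map_inv, hb i hi, hit, inv_mul_cancel]

/-- A length bound for the sequences outside of a reduction system is a degree bound. -/
theorem hilbertIdealBound_of_isReductionSystem [Finite B] (α : Multiplicative (ZMod p) →* B)
    (k : B →* (ZMod p)ˣ)
    (hk : ∀ g v, α (Multiplicative.ofAdd v) * g = g * α (Multiplicative.ofAdd (k g * v)))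
    (hker : k.ker = α.range) {d : ℕ}
    (h : ∀ Good, IsReductionSystem k.range Good → ∀ c : Multiset (ZMod p), c.card = d → Good c) :
    HilbertIdealBound B d := by
  intro R _ _ ρ I hI
  refine pow_le_of_weightSpace (σ := ρ.comp α) sum_zmodChar (fun v => hI _) fun w f hf => ?_
  have := h _ (isReductionSystem_hilbertIdeal α k hk hker ρ hI) (Finset.univ.val.map w) (by simp)
  refine this ?_
  rw [weightProd, Multiset.map_map]
  exact Submodule.prod_mem_finsetProd fun i _ => hf i

end

section ZeroSum

open scoped Pointwise

variable {p : ℕ} [Fact p.Prime]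

/-- A sequence over `ℤ/p` containing enough elements, counted with multiplicities truncated at `h`,
has a nonempty zero-sum subsequence of length at most `h`. -/
theorem exists_short_zero_sum {c : Multiset (ZMod p)} {h : ℕ} (hh : 0 < h)
    (hc : p ≤ ∑ w, min (c.count w) h) :
    ∃ S ≤ c, S ≠ 0 ∧ S.sum = 0 ∧ S.card ≤ h := by
  classical
  by_cases h0 : (0 : ZMod p) ∈ c
  · exact ⟨{0}, Multiset.singleton_le.2 h0, by simp, by simp, by simpa using Nat.succ_le_of_lt hh⟩
  let T : ℕ → Finset (ZMod p) := fun j =>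
    Finset.univ.filter fun x => ∃ S ≤ c, S ≠ 0 ∧ S.sum = x ∧ S.card ≤ j
  let A : ℕ → Finset (ZMod p) := fun j => Finset.univ.filter fun w => j < c.count w
  have hA0 (j) : (0 : ZMod p) ∉ A j := by
    simp [A, Multiset.count_eq_zero_of_notMem h0]
  have hAT (j) : A j ⊆ T (j + 1) := by
    intro w hw
    have hw : j < c.count w := by simpa [A] using hw
    simp only [T, Finset.mem_filter, Finset.mem_univ, true_and]
    exact ⟨{w}, Multiset.singleton_le.2 (Multiset.count_pos.1 (by omega)), by simp, by simp,
      by simp⟩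
  have hsum (j) : ∑ w, min (c.count w) (j + 1) = ∑ w, min (c.count w) j + (A j).card := by
    rw [Finset.card_filter, ← Finset.sum_add_distrib]
    refine Finset.sum_congr rfl fun w _ => ?_
    split_ifs <;> omega
  have key (j : ℕ) : min p (∑ w, min (c.count w) j) ≤ (T j).card := by
    induction j with
    | zero => simp
    | succ j ih =>
      rcases (T j).eq_empty_or_nonempty with hT | hT
      · have : ∑ w, min (c.count w) j = 0 := by
          have := (Fact.out : p.Prime).pos
          rw [hT, Finset.card_empty] at ih
          omega
        rw [hsum, this, zero_add]
        exact (min_le_right _ _).trans (Finset.card_le_card (hAT j))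
      · have hcd := ZMod.cauchy_davenport Fact.out hT (Finset.insert_nonempty 0 (A j))
        rw [Finset.card_insert_of_notMem (hA0 j)] at hcd
        have hsub : T j + insert 0 (A j) ⊆ T (j + 1) := by
          intro x hx
          obtain ⟨y, hy, w, hw, rfl⟩ := Finset.mem_add.1 hx
          obtain ⟨S, hSc, hS0, hSy, hSj⟩ : ∃ S ≤ c, S ≠ 0 ∧ S.sum = y ∧ S.card ≤ j := by
            simpa [T] using hy
          simp only [T, Finset.mem_filter, Finset.mem_univ, true_and]
          rcases Finset.mem_insert.1 hw with rfl | hw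
          · exact ⟨S, hSc, hS0, by rw [hSy, add_zero], by omega⟩
          · have hw : j < c.count w := by simpa [A] using hw
            refine ⟨w ::ₘ S, Multiset.le_iff_count.2 fun v => ?_, by simp, ?_, by simpa using hSj⟩
            · rw [Multiset.count_cons]
              split_ifs with hv
              · have := Multiset.count_le_card v S
                rw [hv] at this ⊢
                omega
              · exact Multiset.le_iff_count.1 hSc v
            · rw [Multiset.sum_cons, hSy, add_comm]
        have := Finset.card_le_card hsub
        rw [hsum]
        omega
  have hTh := key h
  rw [min_eq_left hc] at hTh
  have huniv : T h = Finset.univ := Finset.eq_univ_of_card _ <|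
    le_antisymm (Finset.card_le_univ _) (by rwa [ZMod.card])
  have : (0 : ZMod p) ∈ T h := huniv ▸ Finset.mem_univ _
  simpa [T] using this

theorem exists_zero_sum {c : Multiset (ZMod p)} (hc : p ≤ c.card) :
    ∃ S ≤ c, S ≠ 0 ∧ S.sum = 0 := by
  have hp := (Fact.out : p.Prime).pos
  obtain ⟨S, h1, h2, h3, _⟩ := exists_short_zero_sum (c := c) (h := c.card) (by omega) <| by
    simp_rw [min_eq_left (Multiset.count_le_card _ c)]
    rwa [Multiset.sum_count_eq_card fun a _ => Finset.mem_univ a]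
  exact ⟨S, h1, h2, h3⟩

end ZeroSum

namespace IsReductionSystem

variable {p : ℕ} [Fact p.Prime] {H : Subgroup (ZMod p)ˣ} {Good : Multiset (ZMod p) → Prop}

theorem good_of_zeros (hG : IsReductionSystem H Good) {k : ℕ} (hk : Nat.card H ≤ k)
    (c : Multiset (ZMod p)) : Good (Multiset.replicate k 0 + c) := by
  classical
  obtain ⟨l, rfl⟩ := Nat.exists_eq_add_of_le hk
  let s : Finset (ZMod p) := (Finset.univ.filter fun t : (ZMod p)ˣ => t ∈ H).image Units.val
  have hs : s.card = Nat.card H := by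
    rw [Finset.card_image_of_injective _ Units.val_injective, Nat.card_eq_fintype_card,
      Fintype.card_subtype]
  let u : ZMod p → (ZMod p)ˣ := fun w => if hw : w = 0 then 1 else Units.mk0 w hw
  have hu (t : (ZMod p)ˣ) : u t = t := by
    rw [show u t = _ from dif_neg t.ne_zero]
    ext
    rfl
  have := hG.exchange s u (fun _ => {0}) (Multiset.replicate l 0 + c) ⟨1, by simp [s]⟩
    (fun i hi => by
      obtain ⟨t, ht, rfl⟩ := Finset.mem_image.1 hi
      rw [hu]
      exact (Finset.mem_filter.1 ht).2)
    (fun _ _ => by simp) (fun _ _ => by simp)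
    (fun t ht h => absurd (hu t) (h t (Finset.mem_image_of_mem _ (by simpa using ht))))
  rw [Finset.sum_const, hs, Multiset.nsmul_singleton] at this
  rwa [Multiset.replicate_add, add_assoc]

theorem good_of_last (hG : IsReductionSystem H Good) {k : ℕ} (hk : Nat.card H ≤ k + 1)
    {c : Multiset (ZMod p)} (hc : p ≤ c.card) : Good (Multiset.replicate k 0 + c) := by
  obtain ⟨S, hSc, hS0, hS⟩ := exists_zero_sum hc
  obtain ⟨c', rfl⟩ := Multiset.le_iff_exists_add.1 hSc
  rw [add_left_comm]
  refine hG.contract S _ hS0 hS ?_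
  rw [← Multiset.cons_add, ← Multiset.replicate_succ]
  exact hG.good_of_zeros hk c'

end IsReductionSystem

theorem Finset.exists_filter_le_eq_succ {α : Type*} (O : Finset α) (f : α → ℕ) {h g b : ℕ}
    (hb : (O.filter fun w => h ≤ f w).card ≤ b) (hne : ∃ w ∈ O, h + b * g ≤ f w) :
    ∃ D ⊆ O, D.Nonempty ∧ D.card ≤ b ∧ (∀ w ∈ D, h + g ≤ f w) ∧
      ∀ w ∈ D, ∀ z ∈ O, z ∉ D → f z + g < f w := by
  classical
  let D : ℕ → Finset α := fun i => O.filter fun w => h + i * g ≤ f w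
  have hmono : ∀ i, D (i + 1) ⊆ D i := fun i w hw => by
    simp only [D, Finset.mem_filter] at hw ⊢
    exact ⟨hw.1, le_trans (by gcongr; omega) hw.2⟩
  obtain ⟨i, hib, hi⟩ : ∃ i < b, D i = D (i + 1) := by
    by_contra! hcon
    have hall : ∀ i ≤ b, (D i).card + i ≤ b := by
      intro i
      induction i with
      | zero => intro _; simpa [D] using hb
      | succ i ih =>
        intro hi
        have := Finset.card_lt_card ((hmono i).ssubset_of_ne (hcon i (by omega)).symm)
        have := ih (by omega)
        omega
    obtain ⟨w, hw, hwf⟩ := hne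
    have h1 : w ∈ D b := by simp only [D, Finset.mem_filter]; exact ⟨hw, hwf⟩
    have := Finset.card_pos.2 ⟨w, h1⟩
    have := hall b le_rfl
    omega
  have hle : h + g ≤ h + (i + 1) * g := by
    rw [add_mul, one_mul]; omega
  refine ⟨D i, Finset.filter_subset _ _, ?_, ?_, fun w hw => ?_, fun w hw z hz hzD => ?_⟩
  · obtain ⟨w, hw, hwf⟩ := hne
    refine ⟨w, ?_⟩
    simp only [D, Finset.mem_filter]
    exact ⟨hw, le_trans (by gcongr) hwf⟩
  · refine (Finset.card_le_card fun w hw => ?_).trans hb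
    simp only [D, Finset.mem_filter] at hw ⊢
    exact ⟨hw.1, le_trans (Nat.le_add_right _ _) hw.2⟩
  · rw [hi] at hw
    simp only [D, Finset.mem_filter] at hw
    exact hle.trans hw.2
  · rw [hi] at hw
    simp only [D, Finset.mem_filter, not_and, not_le] at hw hzD
    have := hzD hz
    have := hw.2
    rw [add_mul, one_mul] at this
    omega

/-- A long sequence with few elements counted with truncated multiplicities has an element of
large multiplicity. -/
theorem exists_large_count {p : ℕ} [Fact p.Prime] {c : Multiset (ZMod p)} {h b : ℕ}
    (hb : (Finset.univ.filter fun w => h ≤ c.count w).card ≤ b)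
    (hc : ∑ w, min (c.count w) h < p) (hN : p * (1 + b ^ 3) ≤ c.card) :
    ∃ w, h + b * (p * b) ≤ c.count w := by
  classical
  by_contra! hcon
  have hsum : ∑ w, c.count w = c.card := Multiset.sum_count_eq_card fun a _ => Finset.mem_univ a
  have hle : ∑ w, c.count w ≤
      ∑ w, min (c.count w) h + ∑ w, if h ≤ c.count w then b * (p * b) else 0 := by
    rw [← Finset.sum_add_distrib]
    refine Finset.sum_le_sum fun w _ => ?_
    have := hcon w
    split_ifs <;> omega
  rw [← Finset.sum_filter, Finset.sum_const, smul_eq_mul, hsum] at hle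
  have h1 := Nat.mul_le_mul_right (b * (p * b)) hb
  have h2 : p * (1 + b ^ 3) = p + b * (b * (p * b)) := by ring
  omega

namespace IsReductionSystem

variable {p : ℕ} [Fact p.Prime] {H : Subgroup (ZMod p)ˣ} {Good : Multiset (ZMod p) → Prop}

theorem good_of_exchange (hG : IsReductionSystem H Good) {h b : ℕ} (hb0 : 0 < b)
    {q r : Multiset (ZMod p)} (hr0 : 0 ∉ r)
    (hb : (Finset.univ.filter fun w => h ≤ r.count w).card ≤ b)
    (hc : ∑ w, min (r.count w) h < p) (hN : p * (1 + b ^ 3) ≤ r.card)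
    (ih : ∀ r' : Multiset (ZMod p), 0 ∉ r' → r'.card = r.card →
      ∑ w, r'.count w ^ 2 < ∑ w, r.count w ^ 2 → Good (q + r')) : Good (q + r) := by
  classical
  have hp := (Fact.out : p.Prime).pos
  obtain ⟨w₀, hw₀⟩ := exists_large_count hb hc hN
  have hg : p ≤ p * b := Nat.le_mul_of_pos_right p hb0
  have hcount0 : r.count 0 = 0 := Multiset.count_eq_zero_of_notMem hr0
  have hw₀0 : w₀ ≠ 0 := by
    rintro rfl
    have : 0 < b * (p * b) := by positivity
    omega
  let O : Finset (ZMod p) := Finset.univ.filter fun w => ∃ t ∈ H, (t : ZMod p) * w₀ = w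
  obtain ⟨D, hDO, hDne, hDb, hDp, hDgap⟩ := Finset.exists_filter_le_eq_succ O
    (fun w => r.count w) (g := p * b)
    ((Finset.card_le_card (Finset.filter_subset_filter _ (Finset.subset_univ O))).trans hb)
    ⟨w₀, by simpa [O] using ⟨1, H.one_mem, by simp⟩, hw₀⟩
  have hO : ∀ w ∈ D, ∃ t ∈ H, (t : ZMod p) * w₀ = w := fun w hw => by
    simpa [O] using hDO hw
  choose! u huH hu using hO
  have hD0 : ∀ w ∈ D, w ≠ 0 := by
    rintro w hw rfl
    have := hDp 0 hw
    omega
  have hcountT (T : Finset (ZMod p)) (z : ZMod p) :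
      (∑ w ∈ T, Multiset.replicate p w).count z = if z ∈ T then p else 0 := by
    rw [Multiset.count_sum']
    simp [Multiset.count_replicate]
  obtain ⟨r₁, rfl⟩ : ∃ r₁, r = ∑ w ∈ D, Multiset.replicate p w + r₁ := by
    refine Multiset.le_iff_exists_add.1 (Multiset.le_iff_count.2 fun z => ?_)
    rw [hcountT]
    split_ifs with hz
    · have := hDp z hz
      omega
    · exact Nat.zero_le _
  rw [add_left_comm]
  refine hG.exchange D u (fun w => Multiset.replicate p w) (q + r₁) hDne huH
    (fun w _ => fun h0 => hp.ne' (by simpa using congrArg Multiset.card h0))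
    (fun w _ => by simp) fun t ht htu T hTD hT => ?_
  set z : ZMod p := t * w₀ with hz
  have hz0 : z ≠ 0 := mul_ne_zero t.ne_zero hw₀0
  have hzD : z ∉ D := fun hzD => htu z hzD (Units.ext (mul_right_cancel₀ hw₀0 (hu z hzD)))
  have hzO : z ∈ O := by simpa [O] using ⟨t, ht, hz.symm⟩
  have hmap : ∑ w ∈ T, (Multiset.replicate p w).map
      (fun v => ((t * (u w)⁻¹ : (ZMod p)ˣ) : ZMod p) * v) = T.card • Multiset.replicate p z := by
    rw [← Finset.sum_const]
    refine Finset.sum_congr rfl fun w hw => ?_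
    have : (((u w)⁻¹ : (ZMod p)ˣ) : ZMod p) * w = w₀ := by
      rw [Units.inv_mul_eq_iff_eq_mul, hu w (hTD hw)]
    rw [Multiset.map_replicate, Units.val_mul, mul_assoc, this]
  rw [hmap]
  have hsplit : ∑ w ∈ D, Multiset.replicate p w =
      ∑ w ∈ T, Multiset.replicate p w + ∑ w ∈ D \ T, Multiset.replicate p w := by
    rw [add_comm, Finset.sum_sdiff hTD]
  set y : Multiset (ZMod p) := ∑ w ∈ D \ T, Multiset.replicate p w + r₁ with hy
  have e1 : ∑ w ∈ D, Multiset.replicate p w + r₁ = ∑ w ∈ T, Multiset.replicate p w + y := by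
    rw [hsplit, hy, add_assoc]
  have e2 : T.card • Multiset.replicate p z + ∑ w ∈ D \ T, Multiset.replicate p w + (q + r₁) =
      q + (T.card • Multiset.replicate p z + y) := by
    rw [hy]; abel
  rw [e2]
  have hzT : z ∉ T := fun h => hzD (hTD h)
  have hcz : (∑ w ∈ D, Multiset.replicate p w + r₁).count z = y.count z := by
    rw [e1, Multiset.count_add, hcountT, if_neg hzT, zero_add]
  have hcw : ∀ w ∈ T, (∑ w ∈ D, Multiset.replicate p w + r₁).count w = p + y.count w :=
    fun w hw => by rw [e1, Multiset.count_add, hcountT, if_pos hw]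
  refine ih _ ?_ ?_ ?_
  · rw [e1, Multiset.mem_add, not_or] at hr0
    rw [Multiset.mem_add, not_or]
    refine ⟨fun h => hz0 ?_, hr0.2⟩
    rw [Multiset.nsmul_replicate] at h
    exact (Multiset.eq_of_mem_replicate h).symm
  · rw [e1, Multiset.card_add, Multiset.card_add, Multiset.card_nsmul, Multiset.card_sum]
    simp [hy]
  · rw [e1]
    simp_rw [Multiset.count_add, hcountT, Multiset.count_nsmul, Multiset.count_replicate]
    have hl : ∑ w, (T.card * (if z = w then p else 0) + y.count w) ^ 2 =
        ∑ w, y.count w ^ 2 + ((T.card * p) ^ 2 + 2 * (T.card * p) * y.count z) := by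
      rw [← Finset.sum_erase_add _ _ (Finset.mem_univ z),
        ← Finset.sum_erase_add _ (fun w => y.count w ^ 2) (Finset.mem_univ z), if_pos rfl,
        add_assoc]
      congr 1
      · refine Finset.sum_congr rfl fun w hw => ?_
        rw [if_neg (Finset.ne_of_mem_erase hw).symm, mul_zero, zero_add]
      · ring
    have hr : ∑ w, ((if w ∈ T then p else 0) + y.count w) ^ 2 =
        ∑ w, y.count w ^ 2 + ∑ w ∈ T, (p ^ 2 + 2 * p * y.count w) := by
      rw [← Finset.sum_filter_add_sum_filter_not Finset.univ (· ∈ T),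
        ← Finset.sum_filter_add_sum_filter_not Finset.univ (· ∈ T) (fun w => y.count w ^ 2),
        Finset.filter_mem_eq_inter, Finset.univ_inter, add_right_comm, ← Finset.sum_add_distrib]
      congr 1
      · refine Finset.sum_congr rfl fun w hw => ?_
        rw [if_pos hw]; ring
      · refine Finset.sum_congr rfl fun w hw => ?_
        rw [if_neg (Finset.mem_filter.1 hw).2, zero_add]
    rw [hl, hr]
    refine Nat.add_lt_add_left ?_ _
    have hterm : ∀ w ∈ T, p * (2 * y.count z + 1 + p * T.card) ≤ p ^ 2 + 2 * p * y.count w := by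
      intro w hw
      have h1 := hDgap w (hTD hw) z hzO hzD
      rw [hcz, hcw w hw] at h1
      have h2 : p * T.card ≤ p * b := by
        gcongr; exact (Finset.card_le_card hTD).trans hDb
      have h3 : 2 * y.count z + 1 + p * T.card ≤ p + 2 * y.count w := by omega
      calc _ ≤ p * (p + 2 * y.count w) := by gcongr
        _ = _ := by ring
    have hge := Finset.card_nsmul_le_sum T _ _ hterm
    refine lt_of_lt_of_le ?_ hge
    have hT0 := hT.card_pos
    rw [smul_eq_mul]
    have : 0 < T.card * p := by positivity
    nlinarith

/-- Every sufficiently long sequence is good. -/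
theorem good_of_card_le (hG : IsReductionSystem H Good) {m h b N : ℕ} (hm : Nat.card H = m + 2)
    (hh : 0 < h) (hb0 : 0 < b) (hbh : p ≤ (b + 1) * h) (hN : p * (1 + b ^ 3) ≤ N)
    (hN' : h + p ≤ N) (k : ℕ) {r : Multiset (ZMod p)} (hr0 : 0 ∉ r)
    (hr : m * h + N ≤ r.card + h * k) : Good (Multiset.replicate k 0 + r) := by
  classical
  induction hn : ∑ w, r.count w ^ 2 using Nat.strong_induction_on generalizing k r with
  | _ n ih =>
  subst hn
  rcases le_or_gt (Nat.card H) k with hk | hk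
  · exact hG.good_of_zeros hk r
  rcases le_or_gt (Nat.card H) (k + 1) with hk1 | hk1
  · refine hG.good_of_last hk1 ?_
    obtain rfl : k = m + 1 := by omega
    have : h * (m + 1) = m * h + h := by ring
    omega
  have hrN : N ≤ r.card := by
    have : h * k ≤ h * m := by gcongr; omega
    have : m * h = h * m := mul_comm _ _
    omega
  rcases le_or_gt p (∑ w, min (r.count w) h) with hc | hc
  · obtain ⟨S, hSr, hS0, hS, hSh⟩ := exists_short_zero_sum hh hc
    obtain ⟨r', rfl⟩ := Multiset.le_iff_exists_add.1 hSr
    rw [add_left_comm]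
    refine hG.contract S _ hS0 hS ?_
    rw [← Multiset.cons_add, ← Multiset.replicate_succ]
    refine ih _ ?_ (k + 1) (fun h0 => hr0 (Multiset.mem_add.2 (Or.inr h0))) ?_ rfl
    · obtain ⟨w, hw⟩ := Multiset.exists_mem_of_ne_zero hS0
      refine Finset.sum_lt_sum (fun v _ => ?_) ⟨w, Finset.mem_univ w, ?_⟩
      · rw [Multiset.count_add]; gcongr; omega
      · have := Multiset.count_pos.2 hw
        rw [Multiset.count_add]; gcongr; omega
    · rw [Multiset.card_add] at hr
      rw [mul_add]
      omega
  · refine hG.good_of_exchange (h := h) hb0 hr0 ?_ hc (hN.trans hrN) fun r' hr'0 hr' hlt =>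
      ih _ hlt k hr'0 (by rwa [hr']) rfl
    by_contra! hcon
    have h1 : (Finset.univ.filter fun w => h ≤ r.count w).card • h ≤
        ∑ w ∈ Finset.univ.filter fun w => h ≤ r.count w, min (r.count w) h :=
      Finset.card_nsmul_le_sum _ _ _ fun w hw => le_min (Finset.mem_filter.1 hw).2 le_rfl
    have h2 := Finset.sum_le_univ_sum_of_nonneg (f := fun w => min (r.count w) h)
      (s := Finset.univ.filter fun w => h ≤ r.count w) fun _ => Nat.zero_le _
    have h3 : (b + 1) * h ≤ (Finset.univ.filter fun w => h ≤ r.count w).card * h := by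
      gcongr; omega
    rw [smul_eq_mul] at h1
    omega

/-- The case of a general group of automorphisms. -/
theorem good_of_card_ge (hG : IsReductionSystem H Good) {m h b N : ℕ} (hm : Nat.card H = m + 2)
    (hh : 0 < h) (hb0 : 0 < b) (hbh : p ≤ (b + 1) * h) (hN : p * (1 + b ^ 3) ≤ N)
    (hN' : h + p ≤ N) {c : Multiset (ZMod p)} (hc : m * h + N ≤ c.card) : Good c := by
  classical
  have hsplit : Multiset.replicate (c.count 0) 0 + c.filter (· ≠ 0) = c := by
    rw [← Multiset.filter_eq', Multiset.filter_add_not]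
  rw [← hsplit]
  refine hG.good_of_card_le hm hh hb0 hbh hN hN' _ (by simp) (hc.trans ?_)
  conv_lhs => rw [← hsplit]
  rw [Multiset.card_add, Multiset.card_replicate, add_comm]
  gcongr
  exact Nat.le_mul_of_pos_left _ hh

end IsReductionSystem

namespace IsReductionSystem

variable {p : ℕ} [Fact p.Prime] {H : Subgroup (ZMod p)ˣ} {Good : Multiset (ZMod p) → Prop}

theorem good_of_mem_of_neg_mem (hG : IsReductionSystem H Good) (hm : Nat.card H = 2)
    (hp : p ≠ 2) {c : Multiset (ZMod p)} (hc : p + 2 ≤ c.card) {w : ZMod p} (hw : w ∈ c)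
    (hw' : -w ∈ c) : Good c := by
  have : NeZero (2 : ZMod p) := ⟨fun h => hp (by
    have := (ZMod.natCast_eq_zero_iff 2 p).1 (by exact_mod_cast h)
    exact (Nat.prime_dvd_prime_iff_eq Fact.out Nat.prime_two).1 this)⟩
  by_cases h0 : w = 0
  · obtain ⟨c', rfl⟩ := Multiset.exists_cons_of_mem (h0 ▸ hw)
    rw [Multiset.card_cons] at hc
    have := hG.good_of_last (k := 1) hm.le (c := c') (by omega)
    simpa using this
  · obtain ⟨c', rfl⟩ := Multiset.exists_cons_of_mem hw
    have hne : -w ≠ w := fun h => h0 (by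
      have h2 : 2 * w = 0 := by rw [two_mul]; nth_rewrite 1 [← h]; simp
      exact (mul_eq_zero.1 h2).resolve_left (NeZero.ne 2))
    obtain ⟨c'', rfl⟩ := Multiset.exists_cons_of_mem
      ((Multiset.mem_cons.1 hw').resolve_left hne)
    have hgood := hG.good_of_last (k := 1) hm.le (c := c'') (by
      simp only [Multiset.card_cons] at hc; omega)
    have := hG.contract {w, -w} c'' (by simp) (by simp) (by simpa using hgood)
    simpa using this

/-- The case of a group of automorphisms of order two. -/
theorem good_of_card_eq_two (hG : IsReductionSystem H Good) (hm : Nat.card H = 2) (hp : p ≠ 2)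
    {c : Multiset (ZMod p)} (hc : p + (p + 1) / 2 ≤ c.card) : Good c := by
  classical
  have hp2 := (Fact.out : p.Prime).two_le
  by_cases h : ∃ w ∈ c, -w ∈ c
  · obtain ⟨w, hw, hw'⟩ := h
    exact hG.good_of_mem_of_neg_mem hm hp (by omega) hw hw'
  push Not at h
  have hU : 2 * c.toFinset.card ≤ p - 1 := by
    have hdisj : Disjoint c.toFinset (c.toFinset.image Neg.neg) := by
      rw [Finset.disjoint_left]
      intro w hw hw'
      obtain ⟨v, hv, rfl⟩ := Finset.mem_image.1 hw'
      exact h v (Multiset.mem_toFinset.1 hv) (Multiset.mem_toFinset.1 hw)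
    have hsub : c.toFinset ∪ c.toFinset.image Neg.neg ⊆ Finset.univ.erase 0 := by
      intro w hw
      refine Finset.mem_erase.2 ⟨?_, Finset.mem_univ w⟩
      rintro rfl
      have h0 : (0 : ZMod p) ∈ c := by simpa using hw
      exact h 0 h0 (by simpa using h0)
    have := Finset.card_le_card hsub
    rw [Finset.card_union_of_disjoint hdisj, Finset.card_image_of_injective _ neg_injective,
      Finset.card_erase_of_mem (Finset.mem_univ _), Finset.card_univ, ZMod.card] at this
    omega
  obtain ⟨c', hc'⟩ := Multiset.le_iff_exists_add.1 (Multiset.dedup_le c)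
  have hcard : c.card = c.toFinset.card + c'.card := by
    conv_lhs => rw [hc']
    rw [Multiset.card_add, Multiset.card_toFinset]
  obtain ⟨S, hS, hS0, hSs⟩ := exists_zero_sum (c := c') (by omega)
  obtain ⟨r, rfl⟩ := Multiset.le_iff_exists_add.1 hS
  have hcS : c = S + (c.dedup + r) := by
    conv_lhs => rw [hc']
    abel
  have key := hG.exchange {0} (fun _ => 1) (fun _ => S) (c.dedup + r) (by simp)
    (fun _ _ => H.one_mem) (fun _ _ => hS0) (fun _ _ => hSs) fun t ht ht1 T hT hT0 => by
      have ht1 : t ≠ 1 := fun h => ht1 0 (by simp) h.symm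
      have htn : (t : ZMod p) = -1 := by
        have h1 : (⟨t, ht⟩ : H) ^ 2 = 1 := by rw [← hm]; exact pow_card_eq_one'
        have h2 : (t : ZMod p) ^ 2 = 1 := by
          have := congrArg (fun x : H => ((x : (ZMod p)ˣ) : ZMod p)) h1
          simpa using this
        exact (mul_self_eq_one_iff.1 (by rw [← sq]; exact h2)).resolve_left
          fun h => ht1 (Units.ext h)
      obtain rfl : T = {0} := (Finset.subset_singleton_iff.1 hT).resolve_left hT0.ne_empty
      obtain ⟨w, hw⟩ := Multiset.exists_mem_of_ne_zero hS0
      refine hG.good_of_mem_of_neg_mem hm hp ?_ (w := w) ?_ ?_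
      · have := congrArg Multiset.card hcS
        simp only [Multiset.card_add] at this
        simp only [Finset.sum_singleton, sdiff_self, Finset.bot_eq_empty, Finset.sum_empty,
          Multiset.card_add, Multiset.card_map, Multiset.card_zero]
        omega
      · have : w ∈ c := by rw [hcS]; exact Multiset.mem_add.2 (Or.inl hw)
        simp [this]
      · simp [htn, hw]
  rw [hcS]
  simpa using key

end IsReductionSystem

theorem mul_pow_ten_le_of_mul_le {a e d p m : ℕ} (ha : 0 < a) (h : a * d ≤ e * p)
    (he : m * e ^ 10 ≤ (a * m) ^ 10) : m * d ^ 10 ≤ (p * m) ^ 10 := by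
  have ha' : 0 < a ^ 10 := by positivity
  refine Nat.le_of_mul_le_mul_left ?_ ha'
  calc a ^ 10 * (m * d ^ 10) = m * (a * d) ^ 10 := by ring
    _ ≤ m * (e * p) ^ 10 := by gcongr
    _ = m * e ^ 10 * p ^ 10 := by ring
    _ ≤ (a * m) ^ 10 * p ^ 10 := by gcongr
    _ = _ := by ring

theorem mul_add_three_pow_ten_le {m : ℕ} (h5 : 5 ≤ m) (h64 : m < 64) :
    m * (m + 3) ^ 10 ≤ (2 * m) ^ 10 := by
  interval_cases m <;> norm_num

theorem exists_pow_ten_bounds {m : ℕ} (hm : 64 ≤ m) :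
    ∃ b : ℕ, 0 < b ∧ m * (m + b + (b + 1) * (1 + b ^ 3)) ^ 10 ≤ ((b + 1) * m) ^ 10 := by
  obtain ⟨k, hk, hk'⟩ : ∃ k : ℕ, k ^ 10 ≤ m ∧ m < (k + 1) ^ 10 := by
    refine ⟨Nat.nthRoot 10 m, Nat.pow_nthRoot_le (Or.inl (by norm_num)),
      Nat.lt_pow_nthRoot_add_one (by norm_num) m⟩
  refine ⟨k + 1, k.succ_pos, ?_⟩
  have hk0 : 0 < k := by
    rcases Nat.eq_zero_or_pos k with rfl | h
    · norm_num at hk'; omega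
    · exact h
  obtain ⟨y, hy0, hy⟩ : ∃ y : ℝ, 0 ≤ y ∧ y ^ 10 = m :=
    ⟨(m : ℝ) ^ ((10 : ℕ) : ℝ)⁻¹, by positivity, Real.rpow_inv_natCast_pow (by positivity) (by norm_num)⟩
  have hyk : (k : ℝ) ≤ y := by
    refine le_of_pow_le_pow_left₀ (n := 10) (by norm_num) hy0 ?_
    rw [hy]; exact_mod_cast hk
  have hyk' : y ≤ k + 1 := by
    refine le_of_pow_le_pow_left₀ (n := 10) (by norm_num) (by positivity) ?_
    rw [hy]; exact_mod_cast hk'.le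
  have hcost : ((k : ℝ) + 1) + (k + 1 + 1) * (1 + (k + 1) ^ 3) ≤ y ^ 9 := by
    rcases Nat.lt_or_ge 1 k with h1 | h1
    · refine le_trans ?_ (pow_le_pow_left₀ (by positivity) hyk 9)
      obtain ⟨j, rfl⟩ := Nat.exists_eq_add_of_le h1
      have h2 : (32 : ℝ) ≤ ((1 + 1 + j : ℕ) : ℝ) ^ 5 := by
        refine le_trans (by norm_num) (pow_le_pow_left₀ (by norm_num : (0 : ℝ) ≤ 2) ?_ 5)
        push_cast; linarith [(Nat.cast_nonneg j : (0 : ℝ) ≤ j)]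
      have h3 : (32 : ℝ) * ((1 + 1 + j : ℕ) : ℝ) ^ 4 ≤ ((1 + 1 + j : ℕ) : ℝ) ^ 9 := by
        rw [show (9 : ℕ) = 5 + 4 from rfl, pow_add]; gcongr
      refine le_trans ?_ h3
      have hj : (0 : ℝ) ≤ j := Nat.cast_nonneg j
      push_cast
      rw [← sub_nonneg]
      ring_nf
      positivity
    · obtain rfl : k = 1 := by omega
      have h3 : (3 / 2 : ℝ) ≤ y := by
        refine le_of_pow_le_pow_left₀ (n := 10) (by norm_num) hy0 ?_
        rw [hy]
        refine le_trans (by norm_num : (3 / 2 : ℝ) ^ 10 ≤ (64 : ℕ)) (by exact_mod_cast hm)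
      refine le_trans (by norm_num) (pow_le_pow_left₀ (by norm_num) h3 9)
  have he : (m : ℝ) + (k + 1) + (k + 1 + 1) * (1 + (k + 1) ^ 3) ≤ (k + 1 + 1) * y ^ 9 := by
    have : (m : ℝ) ≤ (k + 1) * y ^ 9 := by
      rw [← hy, pow_succ, mul_comm]; gcongr
    linarith
  have hfin : (m : ℝ) * ((m : ℝ) + (k + 1) + (k + 1 + 1) * (1 + (k + 1) ^ 3)) ^ 10 ≤
      ((k + 1 + 1) * m) ^ 10 := by
    calc _ ≤ (m : ℝ) * ((k + 1 + 1) * y ^ 9) ^ 10 := by gcongr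
      _ = (k + 1 + 1) ^ 10 * (m * (y ^ 10) ^ 9) := by ring
      _ = _ := by rw [hy]; ring
  exact_mod_cast hfin

/-- A length for which the reduction rules apply to every sequence. -/
theorem IsReductionSystem.exists_length {p : ℕ} [Fact p.Prime] (H : Subgroup (ZMod p)ˣ) :
    ∃ d, Nat.card H * d ^ 10 ≤ (p * Nat.card H) ^ 10 ∧
      ∀ Good, IsReductionSystem H Good → ∀ c : Multiset (ZMod p), c.card = d → Good c := by
  have hp := (Fact.out : p.Prime)
  have hp2 := hp.two_le
  have hle : Nat.card H ≤ p - 1 := by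
    have := Nat.card_le_card_of_injective _ H.subtype_injective
    rwa [Nat.card_eq_fintype_card (α := (ZMod p)ˣ), ZMod.card_units] at this
  have hpos : 0 < Nat.card H := Nat.card_pos
  generalize hm : Nat.card H = m at *
  rcases Nat.lt_or_ge m 2 with h2 | h2
  · obtain rfl : m = 1 := by omega
    exact ⟨p, by simp, fun Good hG c hc => by
      simpa using hG.good_of_last (k := 0) hm.le hc.ge⟩
  rcases h2.eq_or_lt with rfl | h2
  · refine ⟨p + (p + 1) / 2, mul_pow_ten_le_of_mul_le (a := 3) (e := 5) (by norm_num) (by omega)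
      (by norm_num), fun Good hG c hc => hG.good_of_card_eq_two hm (by omega) hc.ge⟩
  obtain ⟨l, rfl⟩ : ∃ l, m = l + 2 := ⟨m - 2, by omega⟩
  rcases Nat.lt_or_ge (l + 2) 64 with h64 | h64
  · refine ⟨l * ((p + 1) / 2) + 2 * p, ?_, fun Good hG c hc =>
      hG.good_of_card_ge (b := 1) (N := 2 * p) hm (by omega) one_pos (by omega) (by omega)
        (by omega) hc.ge⟩
    rcases Nat.lt_or_ge (l + 2) 5 with h5 | h5
    · have hp4 : p ≠ 4 := by rintro rfl; norm_num at hp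
      obtain rfl | rfl : l = 1 ∨ l = 2 := by omega
      · exact mul_pow_ten_le_of_mul_le (a := 5) (e := 13) (by norm_num) (by omega) (by norm_num)
      · exact mul_pow_ten_le_of_mul_le (a := 5) (e := 16) (by norm_num) (by omega) (by norm_num)
    · refine mul_pow_ten_le_of_mul_le (a := 2) (e := l + 2 + 3) (by norm_num) ?_
        (mul_add_three_pow_ten_le h5 h64)
      have h1 : 2 * ((p + 1) / 2) ≤ p + 1 := by omega
      have hlp : l ≤ p := by omega
      nlinarith [Nat.mul_le_mul_left l h1]
  · obtain ⟨b, hb, hbm⟩ := exists_pow_ten_bounds h64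
    have hdiv := Nat.div_add_mod (p + b) (b + 1)
    have hmod : (p + b) % (b + 1) < b + 1 := Nat.mod_lt (p + b) (Nat.succ_pos b)
    set h := (p + b) / (b + 1) with hh
    have hbh : p ≤ (b + 1) * h := by
      omega
    have hbh' : (b + 1) * h ≤ p + b := by omega
    have hhpos : 0 < h := Nat.div_pos (by omega) (by omega)
    have hhp : h ≤ p := by
      refine Nat.le_of_mul_le_mul_left (hbh'.trans ?_) (Nat.succ_pos b)
      rw [add_mul, one_mul, add_comm]
      gcongr
      exact Nat.le_mul_of_pos_right b hp.pos
    refine ⟨l * h + p * (1 + b ^ 3), mul_pow_ten_le_of_mul_le b.succ_pos ?_ hbm,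
      fun Good hG c hc => hG.good_of_card_ge hm hhpos hb hbh le_rfl ?_ hc.ge⟩
    · calc (b + 1) * (l * h + p * (1 + b ^ 3))
          = l * ((b + 1) * h) + (b + 1) * (1 + b ^ 3) * p := by ring
        _ ≤ l * (p + b) + (b + 1) * (1 + b ^ 3) * p := by gcongr
        _ = l * p + l * b + (b + 1) * (1 + b ^ 3) * p := by ring
        _ ≤ (l + 2) * p + p * b + (b + 1) * (1 + b ^ 3) * p := by gcongr <;> omega
        _ = _ := by ring
    · have : 1 ≤ b ^ 3 := Nat.one_le_pow _ _ hb
      nlinarith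

/-- The automorphisms of a cyclic group of prime order are the multiplications by units. -/
def ZMod.mulAutMultiplicativeEquivUnits (p : ℕ) :
    MulAut (Multiplicative (ZMod p)) ≃* (ZMod p)ˣ :=
  (MulAutMultiplicative (ZMod p)).trans (ZMod.AddAutEquivUnits p).toMultiplicative

theorem ZMod.ofAdd_mulAutMultiplicativeEquivUnits_mul {p : ℕ}
    (f : MulAut (Multiplicative (ZMod p))) (v : ZMod p) :
    Multiplicative.ofAdd ((ZMod.mulAutMultiplicativeEquivUnits p f : ZMod p) * v) =
      f (Multiplicative.ofAdd v) := by
  conv_rhs => rw [← (ZMod.mulAutMultiplicativeEquivUnits p).symm_apply_apply f]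
  rfl

/-- The degree bound for a group with a self-centralising normal subgroup of prime order. -/
theorem exists_hilbertIdealBound_of_centralizer_le {p : ℕ} [Fact p.Prime] {B : Type*} [Group B]
    [Finite B] (A : Subgroup B) [A.Normal] (hA : Nat.card A = p)
    (hc : Subgroup.centralizer (A : Set B) ≤ A) :
    ∃ d, HilbertIdealBound B d ∧ A.index * d ^ 10 ≤ Nat.card B ^ 10 := by
  let e : Multiplicative (ZMod p) ≃* A := mulEquivOfPrimeCardEq (p := p) (by simp) hA
  let φ := ZMod.mulAutMultiplicativeEquivUnits p
  let k₀ : B →* (ZMod p)ˣ :=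
    φ.toMonoidHom.comp ((MulAut.congr e.symm).toMonoidHom.comp MulAut.conjNormal)
  let α : Multiplicative (ZMod p) →* B := A.subtype.comp e.toMonoidHom
  have hα : α.range = A := by
    rw [MonoidHom.range_comp, MonoidHom.range_eq_top.2 e.surjective, ← MonoidHom.range_eq_map,
      Subgroup.range_subtype]
  have hk₀ (g : B) (v : ZMod p) :
      α (Multiplicative.ofAdd (k₀ g * v)) = g * α (Multiplicative.ofAdd v) * g⁻¹ := by
    have h1 : Multiplicative.ofAdd ((k₀ g : ZMod p) * v) =
        e.symm (MulAut.conjNormal g (e (Multiplicative.ofAdd v))) :=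
      ZMod.ofAdd_mulAutMultiplicativeEquivUnits_mul _ v
    rw [h1]
    simp [α]
  have hk (g : B) (v : ZMod p) : α (Multiplicative.ofAdd v) * g =
      g * α (Multiplicative.ofAdd ((k₀⁻¹ g : (ZMod p)ˣ) * v)) := by
    have := hk₀ g ((k₀⁻¹ g : (ZMod p)ˣ) * v)
    rw [← mul_assoc, ← Units.val_mul, MonoidHom.inv_apply, mul_inv_cancel, Units.val_one,
      one_mul] at this
    rw [this, inv_mul_cancel_right, MonoidHom.inv_apply]
  have hker : k₀⁻¹.ker = α.range := by
    rw [hα]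
    have : IsCyclic A := isCyclic_of_prime_card hA
    have hcomm : A ≤ Subgroup.centralizer (A : Set B) := Subgroup.le_centralizer A
    rw [← le_antisymm hc hcomm]
    ext g
    rw [MonoidHom.mem_ker, MonoidHom.inv_apply, inv_eq_one, Subgroup.mem_centralizer_iff]
    constructor
    · intro hg a ha
      obtain ⟨v, rfl⟩ : ∃ v, α (Multiplicative.ofAdd v) = a := by rwa [SetLike.mem_coe, ← hα] at ha
      have := hk₀ g v
      rw [hg, Units.val_one, one_mul, eq_mul_inv_iff_mul_eq] at this
      exact this
    · intro hg
      refine Units.ext ?_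
      have := hk₀ g 1
      rw [← hg _ (by rw [SetLike.mem_coe, ← hα]; exact ⟨_, rfl⟩), mul_inv_cancel_right,
        mul_one] at this
      exact Multiplicative.ofAdd.injective (e.injective (Subtype.val_injective this))
  obtain ⟨d, hd, hgood⟩ := IsReductionSystem.exists_length k₀⁻¹.range
  refine ⟨d, hilbertIdealBound_of_isReductionSystem α k₀⁻¹ hk hker hgood, ?_⟩
  have hidx : A.index = Nat.card k₀⁻¹.range := by rw [← Subgroup.index_ker, hker, hα]
  rwa [← A.card_mul_index, hA, hidx]

theorem LinearMap.orderOf_le_card_pow_finrank {F V : Type*} [Field F] [Finite F] [AddCommGroup V]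
    [Module F V] [Module.Finite F V] (L : V →ₗ[F] V) :
    orderOf L ≤ Nat.card F ^ Module.finrank F V := by
  have hmon : L.charpoly.Monic := L.charpoly_monic
  have hdeg : L.charpoly.degree = (Module.finrank F V : ℕ) := by
    rw [Polynomial.degree_eq_natDegree hmon.ne_zero, LinearMap.charpoly_natDegree]
  let e : Fin (orderOf L) → Polynomial.degreeLT F (Module.finrank F V) := fun k =>
    ⟨Polynomial.X ^ (k : ℕ) %ₘ L.charpoly, Polynomial.mem_degreeLT.2 <|
      (Polynomial.degree_modByMonic_lt _ hmon).trans_eq hdeg⟩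
  have he : Function.Injective e := fun k l hkl => by
    have h1 := congrArg (Polynomial.aeval L) (congrArg Subtype.val hkl)
    simp only [e] at h1
    rw [Polynomial.aeval_modByMonic_eq_self_of_root L.aeval_self_charpoly,
      Polynomial.aeval_modByMonic_eq_self_of_root L.aeval_self_charpoly, map_pow, map_pow,
      Polynomial.aeval_X] at h1
    exact Fin.ext (pow_injOn_Iio_orderOf k.2 l.2 h1)
  have : Finite (Polynomial.degreeLT F (Module.finrank F V)) :=
    Finite.of_equiv _ (Polynomial.degreeLTEquiv F (Module.finrank F V)).toEquiv.symm
  have := Nat.card_le_card_of_injective e he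
  rw [Nat.card_congr (Polynomial.degreeLTEquiv F (Module.finrank F V)).toEquiv] at this
  simpa [Nat.card_fun] using this

section Elementary

variable {p : ℕ} [Fact p.Prime]

theorem hilbertIdealBound_multiplicative_of_module (W : Type*) [AddCommGroup W] [Finite W]
    [Module (ZMod p) W] {r : ℕ} (hr : Nat.card W = p ^ r) :
    HilbertIdealBound (Multiplicative W) (r * (p - 1) + 1) := by
  have : Module.finrank (ZMod p) W = r := by
    have h1 := Module.natCard_eq_pow_finrank (K := ZMod p) (V := W)
    rw [Nat.card_zmod, hr] at h1
    exact (Nat.pow_right_injective (Fact.out : p.Prime).two_le h1).symm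
  subst this
  have h1 := hilbertIdealBound_pi_zmod p (Fin (Module.finrank (ZMod p) W))
  rw [Fintype.card_fin] at h1
  exact h1.of_mulEquiv (AddEquiv.toMultiplicative
    (Module.finBasis (ZMod p) W).equivFun.toAddEquiv)

theorem AddMonoid.End.orderOf_le_card_of_module (W : Type*) [AddCommGroup W] [Finite W]
    [Module (ZMod p) W] (f : AddMonoid.End W) : orderOf f ≤ Nat.card W := by
  let Φ : AddMonoid.End W →* (W →ₗ[ZMod p] W) :=
    { toFun := fun f => AddMonoidHom.toZModLinearMap p f
      map_one' := rfl
      map_mul' := fun _ _ => rfl }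
  have hΦ : Function.Injective Φ := fun f g hfg => AddMonoidHom.ext fun x =>
    LinearMap.congr_fun hfg x
  rw [← orderOf_injective Φ hΦ f]
  refine (LinearMap.orderOf_le_card_pow_finrank _).trans_eq ?_
  rw [← Module.natCard_eq_pow_finrank]

variable {V : Type*} [CommGroup V] [Finite V]

theorem hilbertIdealBound_of_pow_prime_eq_one (h : ∀ x : V, x ^ p = 1) {r : ℕ}
    (hr : Nat.card V = p ^ r) : HilbertIdealBound V (r * (p - 1) + 1) := by
  let _ := AddCommGroup.zmodModule (G := Additive V) (n := p) h
  exact (hilbertIdealBound_multiplicative_of_module (Additive V) hr).of_mulEquiv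
    MulEquiv.toMultiplicative_toAdditive.symm

theorem MulAut.orderOf_le_card (h : ∀ x : V, x ^ p = 1) (f : MulAut V) :
    orderOf f ≤ Nat.card V := by
  let _ := AddCommGroup.zmodModule (G := Additive V) (n := p) h
  let Φ : MulAut V →* AddMonoid.End (Additive V) :=
    { toFun := fun f => MonoidHom.toAdditive f.toMonoidHom
      map_one' := rfl
      map_mul' := fun _ _ => rfl }
  have hΦ : Function.Injective Φ := fun f g hfg => MulEquiv.ext fun x =>
    congrArg Additive.toMul (DFunLike.congr_fun hfg (Additive.ofMul x))
  rw [← orderOf_injective Φ hΦ f]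
  exact AddMonoid.End.orderOf_le_card_of_module (p := p) (Additive V) (Φ f)

end Elementary

theorem mul_sub_one_add_one_pow_five_le {p r : ℕ} (hp : 2 ≤ p) (hr : 2 ≤ r) :
    (r * (p - 1) + 1) ^ 5 ≤ p ^ (4 * r) := by
  obtain ⟨q, rfl⟩ := Nat.exists_eq_add_of_le' hp
  rw [show q + 2 - 1 = q + 1 by omega]
  induction r, hr using Nat.le_induction with
  | base =>
    rcases lt_or_ge q 2 with hq | hq
    · interval_cases q <;> norm_num
    · have h1 : 2 * (q + 1) + 1 ≤ 2 * (q + 2) := by omega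
      calc (2 * (q + 1) + 1) ^ 5 ≤ (2 * (q + 2)) ^ 5 := by gcongr
        _ = 32 * (q + 2) ^ 5 := by ring
        _ ≤ (q + 2) ^ 3 * (q + 2) ^ 5 := by
          gcongr
          exact le_trans (by norm_num) (Nat.pow_le_pow_left (by omega : 4 ≤ q + 2) 3)
        _ = _ := by ring
  | succ r hr ih =>
    have h1 : 2 * ((r + 1) * (q + 1) + 1) ≤ 3 * (r * (q + 1) + 1) := by nlinarith
    have h2 : 32 * ((r + 1) * (q + 1) + 1) ^ 5 ≤ 243 * (r * (q + 1) + 1) ^ 5 := by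
      have := Nat.pow_le_pow_left h1 5
      rw [mul_pow, mul_pow] at this
      exact this
    have h3 : 16 ≤ (q + 2) ^ 4 := le_trans (by norm_num) (Nat.pow_le_pow_left (by omega : 2 ≤ q + 2) 4)
    rw [mul_add 4, pow_add, mul_one 4]
    have h4 := Nat.mul_le_mul ih h3
    omega

theorem pow_two_mul_mul_pow_ten_le {p r : ℕ} (hp : 2 ≤ p) (hr : 2 ≤ r) :
    p ^ r * p ^ r * (r * (p - 1) + 1) ^ 10 ≤ (p ^ r) ^ 10 := by
  have := Nat.pow_le_pow_left (mul_sub_one_add_one_pow_five_le hp hr) 2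
  calc p ^ r * p ^ r * (r * (p - 1) + 1) ^ 10
      = p ^ r * p ^ r * ((r * (p - 1) + 1) ^ 5) ^ 2 := by ring
    _ ≤ p ^ r * p ^ r * (p ^ (4 * r)) ^ 2 := by gcongr
    _ = _ := by ring

theorem mem_frattini_of_forall {P : Type*} [Group P] {x : P}
    (h : ∀ M : Subgroup P, IsCoatom M → x ∈ M) :
    x ∈ frattini P := by
  simpa [frattini, Order.radical, Subgroup.mem_iInf] using h

namespace IsPGroup

variable {p : ℕ} [Fact p.Prime] {P : Type*} [Group P] [Finite P]

theorem normal_and_card_quotient_of_isCoatom (hP : IsPGroup p P) {M : Subgroup P}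
    (hM : IsCoatom M) : ∃ _ : M.Normal, Nat.card (P ⧸ M) = p := by
  have hnil : Group.IsNilpotent P := hP.isNilpotent
  have htfae := ((Group.isNilpotent_of_finite_tfae (G := P)).out 0 2).1 hnil
  have hn : M.Normal := htfae M hM
  refine ⟨hn, ?_⟩
  have hnt : Nontrivial (P ⧸ M) := by
    refine not_subsingleton_iff_nontrivial.1 fun h => hM.1 ?_
    exact Subgroup.index_eq_one.1 (Nat.card_eq_one_iff_unique.2 ⟨h, ⟨1⟩⟩)
  obtain ⟨n, hn0, hn⟩ := (hP.to_quotient M).nontrivial_iff_card.1 hnt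
  obtain ⟨x, hx⟩ := exists_prime_orderOf_dvd_card' p (hn ▸ dvd_pow_self p hn0.ne')
  have hlt : M < (Subgroup.zpowers x).comap (QuotientGroup.mk' M) := by
    refine lt_of_le_of_ne ?_ fun h => ?_
    · conv_lhs => rw [← QuotientGroup.ker_mk' M]
      exact MonoidHom.comap_bot (QuotientGroup.mk' M) ▸ Subgroup.comap_mono bot_le
    · obtain ⟨y, rfl⟩ := QuotientGroup.mk'_surjective M x
      have hy : y ∈ M := by rw [h]; exact Subgroup.mem_zpowers _
      have : QuotientGroup.mk' M y = 1 := (QuotientGroup.eq_one_iff y).2 hy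
      rw [this, orderOf_one] at hx
      exact (Fact.out : p.Prime).one_lt.ne hx
  have htop := hM.2 _ hlt
  have : Subgroup.zpowers x = ⊤ := by
    refine Subgroup.comap_injective (QuotientGroup.mk'_surjective M) ?_
    rw [htop, Subgroup.comap_top]
  rw [← hx, ← Nat.card_zpowers, this, Subgroup.card_top]

theorem pow_mem_frattini (hP : IsPGroup p P) (x : P) : x ^ p ∈ frattini P := by
  refine mem_frattini_of_forall fun M hM => ?_
  obtain ⟨_, hcard⟩ := hP.normal_and_card_quotient_of_isCoatom hM
  rw [← QuotientGroup.eq_one_iff, QuotientGroup.mk_pow, ← hcard, pow_card_eq_one']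

theorem inv_mul_mul_mem_frattini (hP : IsPGroup p P) (x y : P) :
    (x * y)⁻¹ * (y * x) ∈ frattini P := by
  refine mem_frattini_of_forall fun M hM => ?_
  obtain ⟨_, hcard⟩ := hP.normal_and_card_quotient_of_isCoatom hM
  have := isCyclic_of_prime_card hcard
  rw [← QuotientGroup.eq, QuotientGroup.mk_mul, QuotientGroup.mk_mul]
  exact mul_comm' _ _

/-- The Frattini quotient of a finite `p`-group is abelian. -/
abbrev commGroupQuotientFrattini (hP : IsPGroup p P) : CommGroup (P ⧸ frattini P) :=
  { (inferInstance : Group (P ⧸ frattini P)) with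
    mul_comm := fun a b => by
      induction a using QuotientGroup.induction_on with | H a
      induction b using QuotientGroup.induction_on with | H b
      exact QuotientGroup.eq.2 (hP.inv_mul_mul_mem_frattini a b) }

theorem pow_quotient_frattini_eq_one (hP : IsPGroup p P) (x : P ⧸ frattini P) : x ^ p = 1 := by
  induction x using QuotientGroup.induction_on with | H x
  exact (QuotientGroup.eq_one_iff _).2 (hP.pow_mem_frattini x)

theorem hilbertIdealBound_quotient_frattini (hP : IsPGroup p P) {r : ℕ}
    (hr : (frattini P).index = p ^ r) :
    HilbertIdealBound (P ⧸ frattini P) (r * (p - 1) + 1) := by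
  let _ := hP.commGroupQuotientFrattini
  exact hilbertIdealBound_of_pow_prime_eq_one hP.pow_quotient_frattini_eq_one hr

theorem exists_index_frattini_eq_pow (hP : IsPGroup p P) (hc : ¬ IsCyclic P) :
    ∃ r, 2 ≤ r ∧ (frattini P).index = p ^ r := by
  obtain ⟨r, hr⟩ := hP.index (frattini P)
  refine ⟨r, ?_, hr⟩
  by_contra! hlt
  obtain ⟨x, hx⟩ : ∃ x : P, Subgroup.zpowers x ⊔ frattini P = ⊤ := by
    have hcyc : IsCyclic (P ⧸ frattini P) := by
      obtain rfl | rfl : r = 0 ∨ r = 1 := by omega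
      · rw [pow_zero, Subgroup.index_eq_card, Nat.card_eq_one_iff_unique] at hr
        have := hr.1
        infer_instance
      · rw [pow_one] at hr
        exact isCyclic_of_prime_card hr
    obtain ⟨y, hy⟩ := hcyc.exists_generator
    obtain ⟨x, rfl⟩ := QuotientGroup.mk_surjective y
    refine ⟨x, eq_top_iff.2 fun z _ => ?_⟩
    obtain ⟨n, hn⟩ := Subgroup.mem_zpowers_iff.1 (hy z)
    rw [← QuotientGroup.mk_zpow, QuotientGroup.eq] at hn
    rw [← mul_inv_cancel_left (x ^ n) z]
    exact Subgroup.mul_mem_sup (Subgroup.zpow_mem_zpowers x n) hn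
  have := frattini_nongenerating hx
  exact hc ⟨x, fun z => (this ▸ Subgroup.mem_top z : z ∈ Subgroup.zpowers x)⟩

/-- An automorphism of order prime to `p` acting trivially on the Frattini quotient of a
`p`-group is trivial. -/
theorem mulAut_eq_one_of_quotient_frattini (hP : IsPGroup p P) {f : MulAut P}
    (hf : (orderOf f).Coprime p) (hq : ∀ x, x⁻¹ * f x ∈ frattini P) : f = 1 := by
  by_contra hne
  have hord : orderOf f ≠ 1 := fun h => hne (orderOf_eq_one_iff.1 h)
  obtain ⟨q, hqp, hqd⟩ := Nat.exists_prime_and_dvd hord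
  have : Fact q.Prime := ⟨hqp⟩
  have hqord : orderOf (f ^ (orderOf f / q)) = q :=
    orderOf_pow_orderOf_div (orderOf_pos f).ne' hqd
  set g := f ^ (orderOf f / q) with hg
  have hgq : ∀ (n : ℕ) (x : P), x⁻¹ * (f ^ n) x ∈ frattini P := fun n => by
    induction n with
    | zero => intro x; simp
    | succ n ih =>
      intro x
      have h1 := mul_mem (hq x) (ih (f x))
      rwa [mul_assoc, mul_inv_cancel_left] at h1
  let Z := Subgroup.zpowers g
  have hZ : IsPGroup q Z := IsPGroup.of_card (n := 1) (by rw [Nat.card_zpowers, hqord, pow_one])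
  have hZq : ∀ (s : Z) (x : P), x⁻¹ * (s : MulAut P) x ∈ frattini P := by
    rintro ⟨s, hs⟩ x
    obtain ⟨n, rfl⟩ := mem_powers_iff_mem_zpowers.2 hs
    have := hgq (orderOf f / q * n) x
    rwa [pow_mul, ← hg] at this
  have hcoset : ∀ x : P, ∃ y, y⁻¹ * x ∈ frattini P ∧ g y = y := by
    intro x
    let X : Set P := {y | x⁻¹ * y ∈ frattini P}
    let act : MulAction Z X :=
      { smul := fun s y => ⟨(s : MulAut P) y, by
          have := mul_mem y.2 (hZq s y)
          rwa [mul_assoc, mul_inv_cancel_left] at this⟩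
        one_smul := fun y => rfl
        mul_smul := fun s t y => rfl }
    have hX : Nat.card X = Nat.card (frattini P) :=
      Nat.card_congr ((Equiv.mulLeft x⁻¹).subtypeEquiv fun y => Iff.rfl)
    have hndvd : ¬ q ∣ Nat.card X := by
      rw [hX]
      obtain ⟨n, hn⟩ := IsPGroup.iff_card.1 (hP.to_subgroup (frattini P))
      rw [hn]
      intro h
      have h1 := hqp.dvd_of_dvd_pow h
      exact hqp.one_lt.ne' (Nat.eq_one_of_dvd_coprimes hf hqd h1)
    obtain ⟨y, hy⟩ := hZ.nonempty_fixed_point_of_prime_not_dvd_card X hndvd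
    refine ⟨y, ?_, congrArg Subtype.val (hy ⟨g, Subgroup.mem_zpowers g⟩)⟩
    have := inv_mem (show x⁻¹ * (y : P) ∈ frattini P from y.2)
    rwa [mul_inv_rev, inv_inv] at this
  let Q : Subgroup P := g.toMonoidHom.eqLocus (MonoidHom.id P)
  have hQ : Q ⊔ frattini P = ⊤ := by
    refine eq_top_iff.2 fun x _ => ?_
    obtain ⟨y, hyx, hy⟩ := hcoset x
    rw [← mul_inv_cancel_left y x]
    exact Subgroup.mul_mem_sup hy hyx
  have hQtop := frattini_nongenerating hQ
  have hg1 : g = 1 := MulEquiv.ext fun x => by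
    have : x ∈ Q := by rw [hQtop]; trivial
    exact this
  rw [hg1, orderOf_one] at hqord
  exact hqp.one_lt.ne hqord

theorem orderOf_mulAut_le_index_frattini (hP : IsPGroup p P) {f : MulAut P}
    (hf : (orderOf f).Coprime p) : orderOf f ≤ (frattini P).index := by
  let _ := hP.commGroupQuotientFrattini
  let f' : MulAut (P ⧸ frattini P) := QuotientGroup.congr _ _ f
    (Subgroup.characteristic_iff_map_eq.1 inferInstance f)
  have hf' : ∀ (n : ℕ) (x : P), (f' ^ n) (x : P ⧸ frattini P) = ((f ^ n) x : P) := fun n => by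
    induction n with
    | zero => intro x; rfl
    | succ n ih => intro x; exact ih (f x)
  have hdvd : orderOf f ∣ orderOf f' := by
    refine orderOf_dvd_of_pow_eq_one (hP.mulAut_eq_one_of_quotient_frattini
      (Nat.Coprime.coprime_dvd_left (orderOf_pow_dvd _) hf) fun x => ?_)
    rw [← QuotientGroup.eq, ← hf', pow_orderOf_eq_one]
    rfl
  exact (Nat.le_of_dvd (orderOf_pos f') hdvd).trans
    (MulAut.orderOf_le_card hP.pow_quotient_frattini_eq_one f')

end IsPGroup

theorem Subgroup.isCyclic_map {G H : Type*} [Group G] [Group H] (f : G →* H) (C : Subgroup G)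
    [IsCyclic C] : IsCyclic (C.map f) :=
  isCyclic_of_surjective (f.subgroupMap C) (f.subgroupMap_surjective C)

theorem IsPGroup.exists_hilbertIdealBound {p : ℕ} [Fact p.Prime] {P : Type*} [Group P] [Finite P]
    (hP : IsPGroup p P) : ∃ C : Subgroup P, C.Characteristic ∧ IsCyclic C ∧
      ∃ d, HilbertIdealBound P d ∧ C.index * d ^ 10 ≤ Nat.card P ^ 10 ∧
        (¬ IsCyclic P → C.index * (frattini P).index * d ^ 10 ≤ Nat.card P ^ 10) := by
  induction hn : Nat.card P using Nat.strong_induction_on generalizing P with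
  | _ n ih =>
  subst hn
  by_cases hc : IsCyclic P
  · exact ⟨⊤, inferInstance, inferInstance, Nat.card P, hilbertIdealBound_card P, by simp,
      fun h => absurd hc h⟩
  obtain ⟨r, hr, hi⟩ := hP.exists_index_frattini_eq_pow hc
  have hp := (Fact.out : p.Prime)
  have hcard := (frattini P).card_mul_index
  have hlt : Nat.card (frattini P) < Nat.card P := by
    rw [← hcard, hi]
    exact lt_mul_of_one_lt_right Nat.card_pos (Nat.one_lt_pow (by omega) hp.one_lt)
  obtain ⟨C, hC, hCc, d, hd, hCd, -⟩ := ih _ hlt (hP.to_subgroup _) rfl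
  have hbound := hd.extension (frattini P) (hP.hilbertIdealBound_quotient_frattini hi)
  have hindex : (C.map (frattini P).subtype).index = C.index * p ^ r := by
    rw [Subgroup.index_map_subtype, hi]
  have key : (C.map (frattini P).subtype).index * (frattini P).index *
      (d * (r * (p - 1) + 1)) ^ 10 ≤ Nat.card P ^ 10 := by
    rw [hindex, ← hcard, hi]
    calc C.index * p ^ r * p ^ r * (d * (r * (p - 1) + 1)) ^ 10
        = C.index * d ^ 10 * (p ^ r * p ^ r * (r * (p - 1) + 1) ^ 10) := by ring
      _ ≤ Nat.card (frattini P) ^ 10 * (p ^ r) ^ 10 :=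
        Nat.mul_le_mul hCd (pow_two_mul_mul_pow_ten_le hp.two_le hr)
      _ = _ := by ring
  refine ⟨C.map (frattini P).subtype, inferInstance, Subgroup.isCyclic_map _ C, _, hbound,
    le_trans ?_ key, fun _ => key⟩
  gcongr
  exact Nat.le_mul_of_pos_right _ (by rw [hi]; exact pow_pos hp.pos r)

/-- A bound for the index of a characteristic cyclic subgroup in terms of an upper bound of the
Noether number. -/
def HasCharCyclicBound (G : Type*) [Group G] : Prop :=
  ∃ C : Subgroup G, C.Characteristic ∧ IsCyclic C ∧
    ∃ d, HilbertIdealBound G d ∧ C.index * d ^ 10 ≤ Nat.card G ^ 10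

namespace Subgroup

variable {G : Type*} [Group G]

theorem isCyclic_sup_of_coprime {H K : Subgroup G} [hH : IsCyclic H] [hK : IsCyclic K]
    (hcomm : H ≤ centralizer (K : Set G)) (hc : (Nat.card H).Coprime (Nat.card K)) :
    IsCyclic (H ⊔ K : Subgroup G) := by
  have comm (a : H) (b : K) : Commute (H.subtype a) (K.subtype b) :=
    (mem_centralizer_iff.1 (hcomm a.2) b b.2).symm
  have hprod : IsCyclic (H × K) := Group.isCyclic_prod_iff.2 ⟨hH, hK, hc⟩
  have : (H.subtype.noncommCoprod K.subtype comm).range = H ⊔ K := by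
    rw [MonoidHom.noncommCoprod_range, range_subtype, range_subtype]
  rw [← this]
  exact isCyclic_of_surjective _ (MonoidHom.rangeRestrict_surjective _)

theorem card_mul_card_le_card_sup_of_coprime [Finite G] {H K : Subgroup G}
    (hc : (Nat.card H).Coprime (Nat.card K)) :
    Nat.card H * Nat.card K ≤ Nat.card (H ⊔ K : Subgroup G) :=
  Nat.le_of_dvd Nat.card_pos (hc.mul_dvd_of_dvd_of_dvd (card_dvd_of_le le_sup_left)
    (card_dvd_of_le le_sup_right))

theorem characteristic_of_isCyclic [IsCyclic G] (K : Subgroup G) : K.Characteristic := by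
  refine characteristic_iff_le_comap.2 fun φ x hx => ?_
  obtain ⟨m, hm⟩ := MonoidHom.map_cyclic φ.toMonoidHom
  have : φ x = x ^ m := hm x
  rw [mem_comap]
  exact (this ▸ K.zpow_mem hx m : φ x ∈ K)

theorem index_mul_card_mul_card_le [Finite G] {H K : Subgroup G}
    (hc : (Nat.card H).Coprime (Nat.card K)) :
    (H ⊔ K).index * (Nat.card H * Nat.card K) ≤ Nat.card G := by
  rw [← (H ⊔ K).index_mul_card]
  gcongr
  exact card_mul_card_le_card_sup_of_coprime hc

end Subgroup

theorem Subgroup.pow_card_eq_one_of_mem {G : Type*} [Group G] {H : Subgroup G} {u : G}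
    (hu : u ∈ H) : u ^ Nat.card H = 1 :=
  congrArg Subtype.val (pow_card_eq_one' (x := (⟨u, hu⟩ : H)))

/-- The `n`-th powers of the elements of the centre of a characteristic subgroup form a
characteristic subgroup. -/
theorem Subgroup.exists_characteristic_pow_center {G : Type*} [Group G] (E : Subgroup G)
    [hE : E.Characteristic] (n : ℕ) : ∃ Z : Subgroup G, Z.Characteristic ∧
      ∀ w, w ∈ Z ↔ ∃ v ∈ E, (∀ u ∈ E, Commute u v) ∧ v ^ n = w := by
  let Z : Subgroup G :=
    { carrier := {w | ∃ v ∈ E, (∀ u ∈ E, Commute u v) ∧ v ^ n = w}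
      mul_mem' := by
        rintro _ _ ⟨v, hv, hc, rfl⟩ ⟨v', hv', hc', rfl⟩
        exact ⟨v * v', E.mul_mem hv hv', fun u hu => (hc u hu).mul_right (hc' u hu),
          (hc' v hv).mul_pow n⟩
      one_mem' := ⟨1, E.one_mem, fun u _ => Commute.one_right u, one_pow n⟩
      inv_mem' := by
        rintro _ ⟨v, hv, hc, rfl⟩
        exact ⟨v⁻¹, E.inv_mem hv, fun u hu => (hc u hu).inv_right, inv_pow v n⟩ }
  refine ⟨Z, Subgroup.characteristic_iff_map_le.2 fun φ => ?_, fun w => Iff.rfl⟩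
  rintro _ ⟨_, ⟨v, hv, hc, rfl⟩, rfl⟩
  have hmem (ψ : G ≃* G) {u : G} (hu : u ∈ E) : ψ u ∈ E :=
    Subgroup.characteristic_iff_le_comap.1 hE ψ hu
  refine ⟨φ v, hmem φ hv, fun u hu => ?_, (map_pow φ v n).symm⟩
  have := (hc _ (hmem φ.symm hu)).map φ
  rwa [φ.apply_symm_apply] at this

theorem hasCharCyclicBound_of_not_isCyclic {p : ℕ} [Fact p.Prime] {G : Type*} [Group G] [Finite G]
    (P : Subgroup G) [hPc : P.Characteristic] (hP : IsPGroup p P) (hc : ¬ IsCyclic P)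
    {D : Subgroup (G ⧸ P)} (hD : D.Characteristic) [IsCyclic D] {d : ℕ}
    (hd : HilbertIdealBound (G ⧸ P) d) (hDd : D.index * d ^ 10 ≤ Nat.card (G ⧸ P) ^ 10)
    (hDp : (Nat.card D).Coprime p) : HasCharCyclicBound G := by
  obtain ⟨C, hC, hCc, dP, hdP, -, hCd⟩ := hP.exists_hilbertIdealBound
  specialize hCd hc
  set n := Nat.card P with hn
  set k := Nat.card D with hk
  have hcop : n.Coprime k := by
    obtain ⟨a, ha⟩ := (IsPGroup.iff_card (p := p)).1 hP
    rw [hn, ha]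
    exact (hDp.pow_right a).symm
  let E : Subgroup G := D.comap (QuotientGroup.mk' P)
  have hE : E.Characteristic := Subgroup.Characteristic.comap_quotient_mk (hH := hPc) hD
  have hPE : P ≤ E := by
    intro u hu
    have : (QuotientGroup.mk' P u) = 1 := (QuotientGroup.eq_one_iff u).2 hu
    exact (this ▸ D.one_mem : QuotientGroup.mk' P u ∈ D)
  have hpowP {u : G} (hu : u ∈ E) : u ^ k ∈ P := by
    rw [← QuotientGroup.eq_one_iff, QuotientGroup.mk_pow]
    exact Subgroup.pow_card_eq_one_of_mem hu
  have hpown {u : G} (hu : u ∈ P) : u ^ n = 1 := Subgroup.pow_card_eq_one_of_mem hu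
  obtain ⟨⟨q, hq⟩, hgen⟩ := IsCyclic.exists_generator (α := D)
  obtain ⟨x, rfl⟩ := QuotientGroup.mk_surjective q
  have hx : orderOf (x : G ⧸ P) = k := by
    rw [hk, ← orderOf_eq_card_of_forall_mem_zpowers hgen, Subgroup.orderOf_mk]
  have hxE : x ∈ E := hq
  set y := x ^ n with hy
  have hyE : y ∈ E := E.pow_mem hxE n
  have hyk : y ^ k = 1 := by rw [hy, ← pow_mul, mul_comm, pow_mul, hpown (hpowP hxE)]
  have hymk : orderOf (y : G ⧸ P) = k := by
    rw [hy, QuotientGroup.mk_pow, Nat.Coprime.orderOf_pow (by rw [hx]; exact hcop.symm), hx]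
  have hyord : orderOf y = k := Nat.dvd_antisymm (orderOf_dvd_of_pow_eq_one hyk)
    (hymk ▸ orderOf_map_dvd (QuotientGroup.mk' P) y)
  have hEdecomp {g : G} (hg : g ∈ E) : ∃ i : ℤ, ∃ u ∈ P, g = y ^ i * u := by
    have hle : Subgroup.zpowers (y : G ⧸ P) = D := by
      refine Subgroup.eq_of_le_of_card_ge (Subgroup.zpowers_le.2 hyE) ?_
      rw [Nat.card_zpowers, hymk]
    have : (g : G ⧸ P) ∈ Subgroup.zpowers (y : G ⧸ P) := by rw [hle]; exact hg
    obtain ⟨i, hi⟩ := Subgroup.mem_zpowers_iff.1 this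
    refine ⟨i, (y ^ i)⁻¹ * g, ?_, by group⟩
    rw [← QuotientGroup.eq, QuotientGroup.mk_zpow, hi]
  set f : MulAut P := MulAut.conjNormal y with hf
  set j := orderOf f with hj
  have hjk : j ∣ k := orderOf_dvd_of_pow_eq_one (by rw [hf, ← map_pow, hyk, map_one])
  have hjle : j ≤ (frattini P).index :=
    hP.orderOf_mulAut_le_index_frattini (hDp.coprime_dvd_left hjk)
  have hzP (u : G) (hu : u ∈ P) : u * y ^ j = y ^ j * u := by
    have h1 : MulAut.conjNormal (y ^ j) (⟨u, hu⟩ : P) = ⟨u, hu⟩ := by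
      rw [map_pow, ← hf, hj, pow_orderOf_eq_one, MulAut.one_apply]
    have h2 := congrArg Subtype.val h1
    rw [MulAut.conjNormal_apply] at h2
    exact (mul_inv_eq_iff_eq_mul.1 h2).symm
  obtain ⟨Z, hZ, hmem⟩ := E.exists_characteristic_pow_center n
  have hzZ : (y ^ j) ^ n ∈ Z := by
    refine (hmem _).2 ⟨y ^ j, E.pow_mem hyE j, fun u hu => ?_, rfl⟩
    obtain ⟨i, u, huP, rfl⟩ := hEdecomp hu
    have h1 : Commute (y ^ i) (y ^ j) := ((Commute.refl y).pow_right j).zpow_left i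
    exact h1.mul_left (hzP u huP)
  have hkZ : k ≤ j * Nat.card Z := by
    have hpos : 0 < j * Nat.card Z := Nat.mul_pos (orderOf_pos f) Nat.card_pos
    refine Nat.le_of_dvd hpos ?_
    have h1 : y ^ (j * Nat.card Z * n) = 1 := by
      have := Subgroup.pow_card_eq_one_of_mem hzZ
      rwa [← pow_mul, ← pow_mul, mul_comm n, ← mul_assoc] at this
    have h2 := orderOf_dvd_of_pow_eq_one h1
    rw [hyord] at h2
    exact hcop.symm.dvd_of_dvd_mul_right h2
  have hZE : Z ≤ E := by
    rintro w hw
    obtain ⟨v, hv, -, rfl⟩ := (hmem w).1 hw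
    exact E.pow_mem hv n
  have hZk {w : G} (hw : w ∈ Z) : w ^ k = 1 := by
    obtain ⟨v, hv, -, rfl⟩ := (hmem w).1 hw
    rw [← pow_mul, mul_comm, pow_mul, hpown (hpowP hv)]
  let g : Z →* D := ((QuotientGroup.mk' P).comp Z.subtype).codRestrict D fun w => hZE w.2
  have hg : Function.Injective g := by
    refine (injective_iff_map_eq_one g).2 fun w hw => ?_
    have hwP : (w : G) ∈ P := (QuotientGroup.eq_one_iff _).1 (congrArg Subtype.val hw)
    refine Subtype.ext (orderOf_eq_one_iff.1 (Nat.dvd_one.1 ?_))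
    rw [← hcop]
    exact Nat.dvd_gcd (orderOf_dvd_of_pow_eq_one (hpown hwP))
      (orderOf_dvd_of_pow_eq_one (hZk w.2))
  have hZcyc : IsCyclic Z := isCyclic_of_injective g hg
  have hZcard : Nat.card Z ∣ k := Subgroup.card_dvd_of_injective g hg
  have hCcard : Nat.card (C.map P.subtype) = Nat.card C :=
    Subgroup.card_map_of_injective P.subtype_injective
  have hCZ : (Nat.card (C.map P.subtype)).Coprime (Nat.card Z) := by
    rw [hCcard]
    exact (hcop.coprime_dvd_left C.card_subgroup_dvd_card).coprime_dvd_right hZcard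
  have hCcyc := Subgroup.isCyclic_map P.subtype C
  have hcyc : IsCyclic (C.map P.subtype ⊔ Z : Subgroup G) := by
    refine Subgroup.isCyclic_sup_of_coprime ?_ hCZ
    rintro _ ⟨c, -, rfl⟩
    refine Subgroup.mem_centralizer_iff.2 fun w hw => ?_
    obtain ⟨v, -, hv, rfl⟩ := (hmem w).1 hw
    exact ((hv c (hPE c.2)).pow_right n).symm
  refine ⟨C.map P.subtype ⊔ Z, inferInstance, hcyc, dP * d, hdP.extension P hd, ?_⟩
  have hindex : (C.map P.subtype ⊔ Z).index ≤ D.index * C.index * (frattini P).index := by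
    have h1 := Subgroup.index_mul_card_mul_card_le hCZ
    have hpos : 0 < Nat.card C * Nat.card Z := Nat.mul_pos Nat.card_pos Nat.card_pos
    refine Nat.le_of_mul_le_mul_right ?_ hpos
    rw [hCcard] at h1
    refine h1.trans ?_
    rw [P.card_eq_card_quotient_mul_card_subgroup, ← D.index_mul_card, ← C.index_mul_card, ← hk]
    calc D.index * k * (C.index * Nat.card C)
        ≤ D.index * ((frattini P).index * Nat.card Z) * (C.index * Nat.card C) := by
          gcongr
          exact hkZ.trans (Nat.mul_le_mul_right _ hjle)
      _ = _ := by ring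
  calc (C.map P.subtype ⊔ Z).index * (dP * d) ^ 10
      ≤ D.index * C.index * (frattini P).index * (dP * d) ^ 10 := by gcongr
    _ = D.index * d ^ 10 * (C.index * (frattini P).index * dP ^ 10) := by ring
    _ ≤ Nat.card (G ⧸ P) ^ 10 * n ^ 10 := Nat.mul_le_mul hDd hCd
    _ = Nat.card G ^ 10 := by
      rw [← mul_pow, hn, ← P.card_eq_card_quotient_mul_card_subgroup]

theorem IsPGroup.index_frattini_of_isCyclic {p : ℕ} [Fact p.Prime] {P : Type*} [Group P] [Finite P]
    [Nontrivial P] [IsCyclic P] (hP : IsPGroup p P) : (frattini P).index = p := by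
  have hcyc : IsCyclic (P ⧸ frattini P) :=
    isCyclic_of_surjective _ (QuotientGroup.mk'_surjective (frattini P))
  obtain ⟨y, hy⟩ := hcyc.exists_generator
  have hdvd : (frattini P).index ∣ p := by
    rw [Subgroup.index, ← orderOf_eq_card_of_forall_mem_zpowers hy]
    exact orderOf_dvd_of_pow_eq_one (hP.pow_quotient_frattini_eq_one y)
  refine ((Nat.dvd_prime Fact.out).1 hdvd).resolve_left fun h => ?_
  have h1 : (⊥ : Subgroup P) ⊔ frattini P = ⊤ := by rw [Subgroup.index_eq_one.1 h, sup_top_eq]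
  exact bot_ne_top (frattini_nongenerating h1)

/-- A characteristic abelian Hall subgroup has a characteristic complement in its centraliser. -/
theorem Subgroup.exists_characteristic_complement_centralizer {G : Type*} [Group G] [Finite G]
    (P : Subgroup G) [P.Characteristic] [IsMulCommutative P]
    (hcop : (Nat.card P).Coprime P.index) : ∃ L : Subgroup G, L.Characteristic ∧
      L ⊔ P = centralizer (P : Set G) ∧ (Nat.card L).Coprime (Nat.card P) := by
  set K := centralizer (P : Set G) with hK
  have hPK : P ≤ K := le_centralizer P
  have hcard : Nat.card (P.subgroupOf K) = Nat.card P :=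
    Nat.card_congr (subgroupOfEquivOfLe hPK).toEquiv
  have hcop' : (Nat.card (P.subgroupOf K)).Coprime (P.subgroupOf K).index := by
    rw [hcard]
    exact hcop.coprime_dvd_right (relIndex_dvd_index_of_normal P K)
  obtain ⟨H, hH⟩ := exists_right_complement'_of_coprime hcop'
  have hHcard : (Nat.card H).Coprime (Nat.card P) := by
    rw [← hcard, ← hH.symm.index_eq_card]
    exact hcop'.symm
  have hLcard : Nat.card (H.map K.subtype) = Nat.card H := card_map_of_injective K.subtype_injective
  have hsup : H.map K.subtype ⊔ P = K := by
    have := congrArg (map K.subtype) hH.sup_eq_top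
    rw [map_sup, subgroupOf_map_subtype, inf_of_le_left hPK, ← MonoidHom.range_eq_map,
      range_subtype, sup_comm] at this
    exact this
  refine ⟨H.map K.subtype, ?_, hsup, by rwa [hLcard]⟩
  have hLK : H.map K.subtype ≤ K := le_sup_left.trans hsup.le
  have hKc : K.Characteristic := inferInstance
  have hmem : ∀ g ∈ K, g ^ Nat.card H = 1 → g ∈ H.map K.subtype := by
    intro g hg hg1
    have hnorm : P.Normal := inferInstance
    rw [← hsup, sup_comm] at hg
    obtain ⟨u, hu, l, hl, rfl⟩ := mem_sup_of_normal_left.1 hg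
    have hcomm : Commute u l := mem_centralizer_iff.1 (hLK hl) u hu
    rw [hcomm.mul_pow, ← hLcard, pow_card_eq_one_of_mem hl, mul_one, hLcard] at hg1
    have : u = 1 := orderOf_eq_one_iff.1 (Nat.eq_one_of_dvd_coprimes hHcard
      (orderOf_dvd_of_pow_eq_one hg1) (orderOf_dvd_of_pow_eq_one (pow_card_eq_one_of_mem hu)))
    rwa [this, one_mul]
  refine characteristic_iff_le_comap.2 fun φ x hx => hmem _ ?_ ?_
  · exact characteristic_iff_le_comap.1 hKc φ (hLK hx)
  · rw [← hLcard]
    have := congrArg φ (pow_card_eq_one_of_mem hx)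
    rwa [map_pow, map_one] at this

theorem hasCharCyclicBound_of_isCyclic_sylow {p : ℕ} [Fact p.Prime] {G : Type*} [Group G]
    [Finite G] (P : Subgroup G) [P.Characteristic] [IsCyclic P] (hP : IsPGroup p P) (hne : P ≠ ⊥)
    (hcop : (Nat.card P).Coprime P.index)
    (ih : ∀ H : Subgroup G, H ≠ ⊤ → HasCharCyclicBound H) : HasCharCyclicBound G := by
  obtain ⟨L, hL, hLP, hLcop⟩ := P.exists_characteristic_complement_centralizer hcop
  set K := Subgroup.centralizer (P : Set G) with hK
  have hLPbot : L ⊓ P = ⊥ := (Subgroup.disjoint_of_coprime_natCard hLcop).eq_bot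
  obtain ⟨C, hC, hCc, d, hd, hCd⟩ := ih L fun h => hne (by rw [← hLPbot, h, top_inf_eq])
  have hnt : Nontrivial P := P.nontrivial_iff_ne_bot.2 hne
  set Φ : Subgroup G := (frattini P).map P.subtype with hΦ
  have hΦP : Φ ≤ P := Subgroup.map_subtype_le _
  let N : Subgroup G := L ⊔ Φ
  have hNP : N ⊓ P ≤ Φ := by
    rintro x ⟨hxN, hxP⟩
    obtain ⟨l, hl, u, hu, rfl⟩ := Subgroup.mem_sup_of_normal_left.1 hxN
    have : l ∈ L ⊓ P := ⟨hl, (P.mul_mem_cancel_right (hΦP hu)).1 hxP⟩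
    rw [hLPbot, Subgroup.mem_bot] at this
    rwa [this, one_mul]
  have hPN : P ⊔ N = K := by
    rw [← hLP]
    refine le_antisymm (sup_le le_sup_right (sup_le_sup_left hΦP L)) ?_
    exact sup_le (le_sup_left.trans le_sup_right) le_sup_left
  have hLN : L ≤ N := le_sup_left
  let A : Subgroup (G ⧸ N) := P.map (QuotientGroup.mk' N)
  have hAcomap : A.comap (QuotientGroup.mk' N) = K := by
    rw [Subgroup.comap_map_eq, QuotientGroup.ker_mk', hPN]
  have hAindex : A.index = K.index := by
    rw [← hAcomap, Subgroup.index_comap_of_surjective _ (QuotientGroup.mk'_surjective N)]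
  have hAcard : Nat.card A = p := by
    have h1 : (N.subgroupOf P).index = p := by
      rw [← hP.index_frattini_of_isCyclic, ← Subgroup.inf_subgroupOf_right,
        le_antisymm hNP (le_inf le_sup_right hΦP), hΦ]
      exact congrArg _ (Subgroup.comap_map_eq_self_of_injective P.subtype_injective _)
    rw [← Subgroup.relIndex_ker, QuotientGroup.ker_mk', ← h1, Subgroup.relIndex]
  have hcentr : Subgroup.centralizer (A : Set (G ⧸ N)) ≤ A := by
    intro q hq
    obtain ⟨g, rfl⟩ := QuotientGroup.mk_surjective q
    have h1 : MulAut.conjNormal g = (1 : MulAut P) := by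
      refine hP.mulAut_eq_one_of_quotient_frattini ?_ fun x => ?_
      · refine Nat.Coprime.coprime_dvd_left (orderOf_dvd_of_pow_eq_one (n := P.index) ?_) ?_
        · rw [← map_pow]
          ext u
          rw [MulAut.conjNormal_apply, MulAut.one_apply, mul_inv_eq_iff_eq_mul]
          exact congrArg Subtype.val (mul_comm' (⟨_, P.pow_index_mem g⟩ : P) u)
        · exact hcop.symm.coprime_dvd_right
            (hP.index_frattini_of_isCyclic ▸ (frattini P).index_dvd_card)
      · have h3 : (x : G ⧸ N) * g = g * x :=
          Subgroup.mem_centralizer_iff.1 hq (x : G) ⟨x, x.2, rfl⟩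
        have h4 : (x : G)⁻¹ * (g * x * g⁻¹) ∈ N := by
          rw [← QuotientGroup.eq, QuotientGroup.mk_mul, QuotientGroup.mk_mul, ← h3,
            QuotientGroup.mk_inv, mul_inv_cancel_right]
        have h5 : ((x⁻¹ * MulAut.conjNormal g x : P) : G) ∈ Φ := by
          refine hNP ⟨?_, SetLike.coe_mem _⟩
          rwa [Subgroup.coe_mul, MulAut.conjNormal_apply]
        exact (Subgroup.mem_map_iff_mem P.subtype_injective).1 h5
    have h2 : g ∈ K := by
      refine Subgroup.mem_centralizer_iff.2 fun u hu => ?_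
      have h3 := congrArg Subtype.val (congrArg (fun f : MulAut P => f ⟨u, hu⟩) h1)
      rw [MulAut.conjNormal_apply] at h3
      exact (mul_inv_eq_iff_eq_mul.1 h3).symm
    rwa [← hAcomap] at h2
  have hAnorm : A.Normal := Subgroup.Normal.map inferInstance _ (QuotientGroup.mk'_surjective N)
  obtain ⟨d', hd', hAd⟩ := exists_hilbertIdealBound_of_centralizer_le A hAcard hcentr
  have hNd : HilbertIdealBound N (d * (L.subgroupOf N).index) :=
    (hd.of_mulEquiv (Subgroup.subgroupOfEquivOfLe hLN)).extension _
      (hilbertIdealBound_card (N ⧸ L.subgroupOf N))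
  set b := (L.subgroupOf N).index with hb
  have hNcard : Nat.card N = b * Nat.card L := by
    rw [hb, ← Nat.card_congr (Subgroup.subgroupOfEquivOfLe hLN).toEquiv, Subgroup.index_mul_card]
  have hCcard : Nat.card (C.map L.subtype) = Nat.card C :=
    Subgroup.card_map_of_injective L.subtype_injective
  have hCP : (Nat.card (C.map L.subtype)).Coprime (Nat.card P) := by
    rw [hCcard]
    exact hLcop.coprime_dvd_left C.card_subgroup_dvd_card
  have hLK : L ≤ K := le_sup_left.trans hLP.le
  have hCcyc := Subgroup.isCyclic_map L.subtype C
  have hcyc : IsCyclic (C.map L.subtype ⊔ P : Subgroup G) :=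
    Subgroup.isCyclic_sup_of_coprime ((Subgroup.map_subtype_le C).trans hLK) hCP
  refine ⟨C.map L.subtype ⊔ P, inferInstance, hcyc, _, hNd.extension N hd', ?_⟩
  have hindex : (C.map L.subtype ⊔ P).index ≤ K.index * C.index := by
    have h1 := Subgroup.index_mul_card_mul_card_le hCP
    have hpos : 0 < Nat.card C * Nat.card P := Nat.mul_pos Nat.card_pos Nat.card_pos
    refine Nat.le_of_mul_le_mul_right ?_ hpos
    rw [hCcard] at h1
    refine h1.trans ?_
    have hKcard : Nat.card K ≤ Nat.card L * Nat.card P := by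
      rw [← hLP, ← Subgroup.relIndex_bot_left, ← Subgroup.relIndex_mul_relIndex ⊥ L _ bot_le
        le_sup_left, Subgroup.relIndex_bot_left, Subgroup.relIndex_sup_left]
      gcongr
      exact Nat.le_of_dvd Nat.card_pos (Subgroup.index_dvd_card _)
    rw [← K.index_mul_card]
    calc K.index * Nat.card K ≤ K.index * (C.index * Nat.card C * Nat.card P) := by
          rw [C.index_mul_card]; gcongr
      _ = _ := by ring
  calc (C.map L.subtype ⊔ P).index * (d * b * d') ^ 10
      ≤ K.index * C.index * (d * b * d') ^ 10 := by gcongr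
    _ = K.index * d' ^ 10 * (C.index * d ^ 10) * b ^ 10 := by ring
    _ ≤ Nat.card (G ⧸ N) ^ 10 * Nat.card L ^ 10 * b ^ 10 := by
      rw [← hAindex]; gcongr
    _ = Nat.card G ^ 10 := by
      rw [N.card_eq_card_quotient_mul_card_subgroup, hNcard]; ring

/-- If all characteristic subgroups of prime power order are cyclic, then so are all
characteristic nilpotent subgroups. -/
theorem Subgroup.isCyclic_of_isNilpotent {G : Type*} [Group G] [Finite G]
    (h : ∀ p : ℕ, p.Prime → ∀ P : Subgroup G, P.Characteristic → IsPGroup p P → IsCyclic P)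
    (E : Subgroup G) [hE : E.Characteristic] [Group.IsNilpotent E] : IsCyclic E := by
  have : IsZGroup E := by
    refine ⟨fun p hp S => ?_⟩
    have : Fact p.Prime := ⟨hp⟩
    have : (S : Subgroup E).Characteristic := S.characteristic_of_normal
      (S.normal_of_normalizerCondition Group.normalizerCondition_of_isNilpotent)
    let e := (S : Subgroup E).equivMapOfInjective _ E.subtype_injective
    have := h p hp ((S : Subgroup E).map E.subtype) inferInstance (S.isPGroup'.of_equiv e)
    exact isCyclic_of_surjective e.symm e.symm.surjective
  infer_instance

theorem Subgroup.isNilpotent_of_commutator_le_centralizer {G : Type*} [Group G] (E : Subgroup G)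
    (h : ⁅E, E⁆ ≤ centralizer (E : Set G)) : Group.IsNilpotent E := by
  have : _root_.commutator E ≤ center E := by
    rw [_root_.commutator_def, commutator_le]
    intro a _ b _
    refine mem_center_iff.2 fun c => Subtype.ext ?_
    exact mem_centralizer_iff.1 (h (commutator_mem_commutator a.2 b.2)) c c.2
  exact isNilpotent_of_ker_le_center (Abelianization.of (G := E)) (by rwa [Abelianization.ker_of])

theorem exists_isCyclic_centralizer_le {G : Type*} [Group G] [Finite G] (hG : Group.IsSolvable G)
    (h : ∀ p : ℕ, p.Prime → ∀ P : Subgroup G, P.Characteristic → IsPGroup p P → IsCyclic P) :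
    ∃ F : Subgroup G, F.Characteristic ∧ IsCyclic F ∧ Subgroup.centralizer (F : Set G) ≤ F := by
  obtain ⟨F, ⟨hF, hFc⟩, hmax⟩ :=
    (Set.toFinite {F : Subgroup G | F.Characteristic ∧ IsCyclic F}).exists_maximal
    ⟨⊥, inferInstance, inferInstance⟩
  refine ⟨F, hF, hFc, ?_⟩
  set K := Subgroup.centralizer (F : Set G) with hK
  have hFK : F ≤ K := Subgroup.le_centralizer F
  let D (i : ℕ) : Subgroup G := (derivedSeries K i).map K.subtype
  have hDK (i : ℕ) : D i ≤ K := Subgroup.map_subtype_le _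
  have hstep (i : ℕ) (hi : D (i + 1) ≤ F) : D i ≤ F := by
    have hD : (D i).Characteristic := by
      have := derivedSeries_characteristic K i
      infer_instance
    have hnil : Group.IsNilpotent (D i) := by
      refine Subgroup.isNilpotent_of_commutator_le_centralizer _ ?_
      have : ⁅D i, D i⁆ = D (i + 1) := by
        simp only [D]
        rw [← Subgroup.map_commutator, derivedSeries_succ]
      rw [this]
      exact hi.trans (Subgroup.le_centralizer_iff.1 (hDK i))
    have hcyc : IsCyclic (D i) := Subgroup.isCyclic_of_isNilpotent h (D i)
    have hsup : D i ⊔ F ≤ Subgroup.centralizer ((D i ⊔ F : Subgroup G) : Set G) := by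
      have h1 : D i ⊔ F ≤ Subgroup.centralizer (D i : Set G) :=
        sup_le (Subgroup.le_centralizer _) (Subgroup.le_centralizer_iff.1 (hDK i))
      have h2 : D i ⊔ F ≤ Subgroup.centralizer (F : Set G) := sup_le (hDK i) hFK
      exact sup_le (Subgroup.le_centralizer_iff.1 h1) (Subgroup.le_centralizer_iff.1 h2)
    have hnil' : Group.IsNilpotent (D i ⊔ F : Subgroup G) :=
      Subgroup.isNilpotent_of_commutator_le_centralizer _
        ((Subgroup.commutator_le_left _ _).trans hsup)
    exact le_sup_left.trans (hmax ⟨inferInstance, Subgroup.isCyclic_of_isNilpotent h _⟩ le_sup_right)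
  obtain ⟨n, hn⟩ := (inferInstance : Group.IsSolvable K).solvable
  have hDn : D n ≤ F := by simp [D, hn]
  have hD0 : D 0 ≤ F := Nat.decreasingInduction' (fun k _ _ hk => hstep k hk) n.zero_le hDn
  refine le_trans (le_of_eq ?_) hD0
  simp [D, ← MonoidHom.range_eq_map]

theorem Nat.coprime_totient_of_forall_le {p n : ℕ} (hp : p.Prime) (hn : n.Coprime p)
    (h : ∀ r, r.Prime → r ∣ n → r ≤ p) : (Nat.totient n).Coprime p := by
  refine ((Nat.Prime.coprime_iff_not_dvd hp).2 fun hdvd => ?_).symm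
  have h1 : p ∣ n * ∏ r ∈ n.primeFactors, (r - 1) := by
    rw [← Nat.totient_mul_prod_primeFactors]
    exact hdvd.mul_right _
  obtain h2 | h2 := hp.dvd_mul.1 h1
  · exact (Nat.Prime.coprime_iff_not_dvd hp).1 hn.symm h2
  · obtain ⟨r, hr, hpr⟩ := (hp.prime.dvd_finsetProd_iff _).1 h2
    have hrp := Nat.prime_of_mem_primeFactors hr
    have h3 := h r hrp (Nat.dvd_of_mem_primeFactors hr)
    have h4 := Nat.le_of_dvd (Nat.sub_pos_of_lt hrp.one_lt) hpr
    have := hrp.pos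
    omega

/-- A self-centralising characteristic cyclic subgroup contains the elements of `p`-power order
for the largest prime divisor `p` of the group order. -/
theorem mem_of_pow_prime_pow_eq_one {p : ℕ} [Fact p.Prime] {G : Type*} [Group G] [Finite G]
    (h : ∀ p : ℕ, p.Prime → ∀ P : Subgroup G, P.Characteristic → IsPGroup p P → IsCyclic P)
    (hp : ∀ r, r.Prime → r ∣ Nat.card G → r ≤ p) (F : Subgroup G) [hF : F.Characteristic]
    [IsCyclic F] (hc : Subgroup.centralizer (F : Set G) ≤ F) {g : G} {k : ℕ}
    (hg : g ^ p ^ k = 1) : g ∈ F := by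
  have hpp : p.Prime := Fact.out
  let χ : G →* (ZMod (Nat.card F))ˣ :=
    (IsCyclic.mulAutMulEquiv F).toMonoidHom.comp MulAut.conjNormal
  have hχ (x : G) : χ x = 1 ↔ x ∈ F := by
    have h1 : χ x = 1 ↔ MulAut.conjNormal x = (1 : MulAut F) :=
      EmbeddingLike.map_eq_one_iff (f := IsCyclic.mulAutMulEquiv F)
    rw [h1]
    constructor
    · intro hx
      refine hc (Subgroup.mem_centralizer_iff.2 fun u hu => ?_)
      have h3 := congrArg Subtype.val (congrArg (fun f : MulAut F => f ⟨u, hu⟩) hx)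
      rw [MulAut.conjNormal_apply] at h3
      exact (mul_inv_eq_iff_eq_mul.1 h3).symm
    · intro hx
      ext u
      rw [MulAut.conjNormal_apply, MulAut.one_apply, mul_inv_eq_iff_eq_mul]
      exact congrArg Subtype.val (mul_comm' (⟨x, hx⟩ : F) u)
  let N : Subgroup G :=
    { carrier := {x | ∃ k, x ^ p ^ k ∈ F}
      mul_mem' := by
        rintro x y ⟨k, hk⟩ ⟨l, hl⟩
        refine ⟨k + l, (hχ _).1 ?_⟩
        rw [← hχ, map_pow] at hk hl
        rw [map_pow, map_mul, mul_pow, pow_add, pow_mul, hk, one_pow, one_mul, mul_comm, pow_mul,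
          hl, one_pow]
      one_mem' := ⟨0, by simp⟩
      inv_mem' := by
        rintro x ⟨k, hk⟩
        exact ⟨k, by rw [inv_pow]; exact F.inv_mem hk⟩ }
  have hN : N.Characteristic := by
    refine Subgroup.characteristic_iff_le_comap.2 fun φ x hx => ?_
    obtain ⟨k, hk⟩ := hx
    refine ⟨k, ?_⟩
    have := Subgroup.characteristic_iff_le_comap.1 hF φ hk
    rwa [Subgroup.mem_comap, map_pow] at this
  have hFN : F ≤ N := fun x hx => ⟨0, by simpa using hx⟩
  set m := ordCompl[p] (Nat.card F) with hm
  have hmcop : m.Coprime p := (Nat.coprime_ordCompl hpp Nat.card_pos.ne').symm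
  let Q : Subgroup G :=
    { carrier := {x | x ∈ F ∧ x ^ m = 1}
      mul_mem' := by
        rintro x y ⟨hx, hx'⟩ ⟨hy, hy'⟩
        have : Commute x y := congrArg Subtype.val (mul_comm' (⟨x, hx⟩ : F) ⟨y, hy⟩)
        exact ⟨F.mul_mem hx hy, by rw [this.mul_pow, hx', hy', one_mul]⟩
      one_mem' := ⟨F.one_mem, one_pow m⟩
      inv_mem' := by
        rintro x ⟨hx, hx'⟩
        exact ⟨F.inv_mem hx, by rw [inv_pow, hx', inv_one]⟩ }
  have hQF : Q ≤ F := fun x hx => hx.1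
  have hQ : Q.Characteristic := by
    refine Subgroup.characteristic_iff_le_comap.2 fun φ x hx => ?_
    refine ⟨Subgroup.characteristic_iff_le_comap.1 hF φ hx.1, ?_⟩
    have := congrArg φ hx.2
    rwa [map_pow, map_one] at this
  have hQcyc : IsCyclic Q := isCyclic_of_injective (Subgroup.inclusion hQF)
    (Subgroup.inclusion_injective hQF)
  have hQcop : (Nat.card Q).Coprime p := by
    obtain ⟨x, hx⟩ := hQcyc.exists_generator
    rw [← orderOf_eq_card_of_forall_mem_zpowers hx]
    refine hmcop.coprime_dvd_left (orderOf_dvd_of_pow_eq_one (Subtype.ext ?_))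
    exact x.2.2
  have hcomm (x : G) (hx : x ∈ N) (u : G) (hu : u ∈ Q) : x * u = u * x := by
    obtain ⟨k, hk⟩ := hx
    have h1 : MulAut.conjNormal x ^ p ^ k = (1 : MulAut Q) := by
      rw [← map_pow]
      ext u
      rw [MulAut.conjNormal_apply, MulAut.one_apply, mul_inv_eq_iff_eq_mul]
      exact congrArg Subtype.val (mul_comm' (⟨_, hk⟩ : F) ⟨u, hQF u.2⟩)
    have h2 : (Nat.card (MulAut Q)).Coprime p := by
      rw [IsCyclic.card_mulAut]
      exact Nat.coprime_totient_of_forall_le hpp hQcop fun r hr hrQ =>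
        hp r hr (hrQ.trans Q.card_subgroup_dvd_card)
    have h3 : MulAut.conjNormal x = (1 : MulAut Q) := orderOf_eq_one_iff.1
      (Nat.eq_one_of_dvd_coprimes (h2.pow_right k) (orderOf_dvd_natCard _)
        (orderOf_dvd_of_pow_eq_one h1))
    have h4 := congrArg Subtype.val (congrArg (fun f : MulAut Q => f ⟨u, hu⟩) h3)
    rw [MulAut.conjNormal_apply] at h4
    exact mul_inv_eq_iff_eq_mul.1 h4
  have hnil : Group.IsNilpotent N := by
    let f : N →* G ⧸ Q := (QuotientGroup.mk' Q).comp N.subtype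
    have hrange : IsPGroup p f.range := by
      rintro ⟨_, x, rfl⟩
      obtain ⟨k, hk⟩ := x.2
      refine ⟨k + (Nat.card F).factorization p, Subtype.ext ?_⟩
      refine (map_pow f x _).symm.trans ((QuotientGroup.eq_one_iff _).2 ?_)
      refine ⟨?_, ?_⟩
      · rw [map_pow, Subgroup.subtype_apply, pow_add, pow_mul]
        exact F.pow_mem hk _
      · rw [map_pow, Subgroup.subtype_apply, ← pow_mul, pow_add, mul_assoc, hm,
          Nat.ordProj_mul_ordCompl_eq_self, pow_mul]
        exact Subgroup.pow_card_eq_one_of_mem hk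
    have := hrange.isNilpotent
    refine Subgroup.isNilpotent_of_ker_le_center f.rangeRestrict ?_
    rw [MonoidHom.ker_rangeRestrict]
    intro u hu
    refine Subgroup.mem_center_iff.2 fun x => Subtype.ext ?_
    exact hcomm x x.2 u ((QuotientGroup.eq_one_iff _).1 hu)
  have hNcyc : IsCyclic N := Subgroup.isCyclic_of_isNilpotent h N
  have hgN : g ∈ N := ⟨k, hg ▸ F.one_mem⟩
  refine hc (Subgroup.mem_centralizer_iff.2 fun u hu => ?_)
  exact congrArg Subtype.val (mul_comm' (⟨u, hFN hu⟩ : N) ⟨g, hgN⟩)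

theorem hasCharCyclicBound_of_isSolvable {G : Type*} [Group G] [Finite G]
    (hG : Group.IsSolvable G) : HasCharCyclicBound G := by
  induction hn : Nat.card G using Nat.strong_induction_on generalizing G with
  | _ n ih =>
  subst hn
  by_cases h : ∀ p : ℕ, p.Prime → ∀ P : Subgroup G, P.Characteristic → IsPGroup p P → IsCyclic P
  · by_cases hG1 : Nat.card G = 1
    · have := (Nat.card_eq_one_iff_unique.1 hG1).1
      exact ⟨⊤, inferInstance, inferInstance, _, hilbertIdealBound_card G, by simp⟩
    obtain ⟨p, hp, hmax⟩ := (Nat.card G).primeFactors.exists_max_image id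
      (Nat.nonempty_primeFactors.2 (lt_of_le_of_ne Nat.card_pos (Ne.symm hG1)))
    have hpp := Nat.prime_of_mem_primeFactors hp
    have : Fact p.Prime := ⟨hpp⟩
    obtain ⟨F, hF, hFc, hFF⟩ := exists_isCyclic_centralizer_le hG h
    obtain ⟨S⟩ : Nonempty (Sylow p G) := inferInstance
    have hSF : (S : Subgroup G) ≤ F := by
      intro g hg
      obtain ⟨k, hk⟩ := S.isPGroup' ⟨g, hg⟩
      refine mem_of_pow_prime_pow_eq_one h (fun r hr hrG => ?_) F hFF (congrArg Subtype.val hk)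
      exact hmax r (Nat.mem_primeFactors.2 ⟨hr, hrG, Nat.card_pos.ne'⟩)
    have hS : (S : Subgroup G).Characteristic := by
      have := ((S : Subgroup G).subgroupOf F).characteristic_of_isCyclic
      rw [← Subgroup.map_subgroupOf_eq_of_le hSF]
      infer_instance
    have := h p hpp S hS S.isPGroup'
    refine hasCharCyclicBound_of_isCyclic_sylow (S : Subgroup G) S.isPGroup'
      (S.ne_bot_of_dvd_card (Nat.dvd_of_mem_primeFactors hp)) S.card_coprime_index fun H hH => ?_
    refine ih _ (lt_of_le_of_ne (Subgroup.card_le_card_group H) fun h => hH ?_) inferInstance rfl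
    exact Subgroup.eq_top_of_card_eq H h
  · push Not at h
    obtain ⟨p, hpp, P₀, hP₀⟩ := h
    have : Fact p.Prime := ⟨hpp⟩
    obtain ⟨P, ⟨hP, hPp, hPc⟩, hmax⟩ := (Set.toFinite {P : Subgroup G | P.Characteristic ∧
      IsPGroup p P ∧ ¬ IsCyclic P}).exists_maximal ⟨P₀, hP₀⟩
    have hPbot : P ≠ ⊥ := by
      rintro rfl
      exact hPc inferInstance
    have hlt : Nat.card (G ⧸ P) < Nat.card G := by
      rw [P.card_eq_card_quotient_mul_card_subgroup]
      exact lt_mul_of_one_lt_right Nat.card_pos ((Subgroup.one_lt_card_iff_ne_bot P).2 hPbot)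
    obtain ⟨D, hD, hDc, d, hd, hDd⟩ := ih _ hlt (G := G ⧸ P) inferInstance rfl
    refine hasCharCyclicBound_of_not_isCyclic P hPp hPc hD hd hDd ?_
    refine ((Nat.Prime.coprime_iff_not_dvd hpp).2 fun hdvd => ?_).symm
    obtain ⟨x, hx⟩ := exists_prime_orderOf_dvd_card' p hdvd
    have hZ := (Subgroup.zpowers x).characteristic_of_isCyclic
    let Z : Subgroup (G ⧸ P) := (Subgroup.zpowers x).map D.subtype
    have hZp : IsPGroup p Z := by
      refine IsPGroup.map (IsPGroup.of_card (n := 1) ?_) D.subtype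
      rw [Nat.card_zpowers, hx, pow_one]
    have hR : (Z.comap (QuotientGroup.mk' P)).Characteristic :=
      Subgroup.Characteristic.comap_quotient_mk (hH := hP) inferInstance
    have hRp : IsPGroup p (Z.comap (QuotientGroup.mk' P)) :=
      hZp.comap_of_ker_isPGroup _ (by rwa [QuotientGroup.ker_mk'])
    have hle : P ≤ Z.comap (QuotientGroup.mk' P) := by
      conv_lhs => rw [← QuotientGroup.ker_mk' P]
      exact MonoidHom.ker_le_comap _ _
    have hRP := hmax ⟨hR, hRp, fun hc => hPc (isCyclic_of_injective (Subgroup.inclusion hle)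
      (Subgroup.inclusion_injective hle))⟩ hle
    obtain ⟨g, hg⟩ := QuotientGroup.mk_surjective (x : G ⧸ P)
    have hgP : g ∈ P := hRP (show (g : G ⧸ P) ∈ Z from hg ▸ ⟨x, Subgroup.mem_zpowers x, rfl⟩)
    have hx1 : x = 1 := Subtype.ext (hg.symm.trans ((QuotientGroup.eq_one_iff g).2 hgP))
    rw [hx1, orderOf_one] at hx
    exact hpp.one_lt.ne hx

/-- **Theorem 1, solvable case.**  A finite solvable group `G` has a characteristic
cyclic subgroup of index at most `n(G) ^ 10`. -/
theorem solvable_group_has_char_cyclic_subgroup_of_small_index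
    (G : Type) [Group G] [Finite G] (hsolv : IsSolvable G) :
    ∃ C : Subgroup G, C.Characteristic ∧ IsCyclic ↥C ∧
      (C.index : ℝ) ≤ noetherIndex G ^ (10 : ℕ) := by
  obtain ⟨C, hC, hCc, d, hd, hCd⟩ := hasCharCyclicBound_of_isSolvable hsolv
  refine ⟨C, hC, hCc, ?_⟩
  have hβ : (0 : ℝ) < noetherNumber G := Nat.cast_pos.2 (noetherNumber_pos G)
  rw [noetherIndex, div_pow, le_div_iff₀ (pow_pos hβ 10)]
  have h1 : C.index * noetherNumber G ^ 10 ≤ Nat.card G ^ 10 :=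
    (Nat.mul_le_mul_left _ (Nat.pow_le_pow_left hd.noetherNumber_le 10)).trans hCd
  exact_mod_cast h1
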